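/- arXiv:1902.08857 — 2 statements merged into one kernel-verified Lean document; each statement's English description precedes it below -/
import Mathlib

section
/- Let f be a homogeneous polynomial of degree 3 in four variables over ℂ defining a smooth cubic surface, i.e. for every nonzero x ∈ ℂ⁴ with f(x) = 0, the gradient (∂f/∂x₀(x), ∂f/∂x₁(x), ∂f/∂x₂(x), ∂f/∂x₃(x)) is nonzero. Then the set of lines in ℙ³ contained in the surface X = {f = 0} — equivalently, the set of 2-dimensional ℂ-linear subspaces W ⊆ ℂ⁴ such that f vanishes identically on W — is finite and has exactly 27 elements. (Theorem of Salmon and Cayley.) -/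
open MvPolynomial

section Core
variable {V : Type*} [AddCommGroup V] [Module ℂ V]

/-- symmetric trilinear form whose cubic is smooth -/
structure SmCub (T : V →ₗ[ℂ] V →ₗ[ℂ] V →ₗ[ℂ] ℂ) : Prop where
  s12 : ∀ x y z, T x y z = T y x z
  s23 : ∀ x y z, T x y z = T x z y
  sm : ∀ x, x ≠ 0 → ∃ y, T x x y ≠ 0

/-- 2-dimensional subspace on which the cubic vanishes -/
def IsLn (T : V →ₗ[ℂ] V →ₗ[ℂ] V →ₗ[ℂ] ℂ) (W : Submodule ℂ V) : Prop :=
  Module.finrank ℂ W = 2 ∧ ∀ x ∈ W, T x x x = 0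

variable {T : V →ₗ[ℂ] V →ₗ[ℂ] V →ₗ[ℂ] ℂ}

lemma SmCub.s13 (h : SmCub T) (x y z : V) : T x y z = T z y x := by
  rw [h.s12, h.s23, h.s12]

lemma SmCub.cube_add (h : SmCub T) (x y : V) :
    T (x + y) (x + y) (x + y) = T x x x + 3 * T x x y + 3 * T x y y + T y y y := by
  simp only [map_add, LinearMap.add_apply]
  rw [h.s12 y x x, h.s23 x y x, h.s12 y x y, h.s13 y y x]; ring

lemma SmCub.polar2 (h : SmCub T) {W : Submodule ℂ V} (hW : ∀ x ∈ W, T x x x = 0)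
    {x y : V} (hx : x ∈ W) (hy : y ∈ W) : T x x y = 0 := by
  have h1 := h.cube_add x y
  have h2 := h.cube_add x (-y)
  rw [hW _ (W.add_mem hx hy), hW _ hx, hW _ hy] at h1
  rw [hW _ (W.add_mem hx (W.neg_mem hy)), hW _ hx, hW _ (W.neg_mem hy)] at h2
  simp only [map_neg, LinearMap.neg_apply] at h2
  linear_combination (-1/6) * h1 + (1/6) * h2

lemma SmCub.sq_add (h : SmCub T) (x y z : V) :
    T (x + y) (x + y) z = T x x z + 2 * T x y z + T y y z := by
  simp only [map_add, LinearMap.add_apply]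
  rw [h.s12 y x z]; ring

lemma SmCub.polar3 (h : SmCub T) {W : Submodule ℂ V} (hW : ∀ x ∈ W, T x x x = 0)
    {x y z : V} (hx : x ∈ W) (hy : y ∈ W) (hz : z ∈ W) : T x y z = 0 := by
  have h1 := h.sq_add x y z
  rw [h.polar2 hW (W.add_mem hx hy) hz, h.polar2 hW hx hz, h.polar2 hW hy hz] at h1
  linear_combination (-1/2) * h1

lemma exists_quad_root (a b c : ℂ) : ∃ s t : ℂ, (s ≠ 0 ∨ t ≠ 0) ∧ a * s ^ 2 + 2 * b * s * t + c * t ^ 2 = 0 := by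
  by_cases ha : a = 0
  · exact ⟨1, 0, by simp, by simp [ha]⟩
  · obtain ⟨r, hr⟩ := IsAlgClosed.exists_pow_nat_eq (b ^ 2 - a * c) (n := 2) (by norm_num)
    refine ⟨(r - b), a, Or.inr ha, ?_⟩
    linear_combination a * hr

variable [FiniteDimensional ℂ V]

/-- no plane section containing a double line -/
lemma SmCub.nd (h : SmCub T) (hV : Module.finrank ℂ V = 4) {P N : Submodule ℂ V}
    (hP : Module.finrank ℂ P = 3) (hN : 2 ≤ Module.finrank ℂ N)
    (hT : ∀ x ∈ N, ∀ y ∈ P, T x x y = 0) : False := by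
  obtain ⟨w, hw⟩ : ∃ w, w ∉ P := by
    by_contra hc; push Not at hc
    have : P = ⊤ := by ext; simp [hc]
    rw [this, finrank_top] at hP; omega
  have hsup : P ⊔ Submodule.span ℂ {w} = ⊤ := by
    apply Submodule.eq_top_of_finrank_eq
    have h1 : P < P ⊔ Submodule.span ℂ {w} := by
      refine lt_of_le_of_ne le_sup_left fun he => hw ?_
      rw [he]; exact Submodule.mem_sup_right (Submodule.mem_span_singleton_self w)
    have := Submodule.finrank_lt_finrank_of_lt h1
    have := Submodule.finrank_le (P ⊔ Submodule.span ℂ {w})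
    omega
  obtain ⟨n, hn⟩ : ∃ n : Fin 2 → N, LinearIndependent ℂ n :=
    exists_linearIndependent_of_le_finrank hN
  obtain ⟨s, t, hst, hq⟩ := exists_quad_root (T (n 0) (n 0) w) (T (n 0) (n 1) w) (T (n 1) (n 1) w)
  set x : N := s • n 0 + t • n 1 with hx
  have hx0 : (x : V) ≠ 0 := by
    intro h0
    have h0' : x = 0 := by exact_mod_cast h0
    have := Fintype.linearIndependent_iff.1 hn ![s, t] (by simp [Fin.sum_univ_two, ← hx, h0'])
    have a := this 0; have b := this 1
    simp at a b; simp [a, b] at hst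
  obtain ⟨y, hy⟩ := h.sm x hx0
  apply hy
  have hy' : y ∈ P ⊔ Submodule.span ℂ {w} := by rw [hsup]; trivial
  obtain ⟨p, hp, q, hq', rfl⟩ := Submodule.mem_sup.1 hy'
  obtain ⟨c, rfl⟩ := Submodule.mem_span_singleton.1 hq'
  rw [map_add, hT _ x.2 _ hp, map_smul]
  have : T x x w = 0 := by
    rw [hx]; push_cast; rw [h.sq_add]
    simp only [map_smul, LinearMap.smul_apply, smul_eq_mul]
    linear_combination hq
  simp [this]

lemma finrank_inf_ker_ge (P : Submodule ℂ V) (L : V →ₗ[ℂ] ℂ) :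
    Module.finrank ℂ P ≤ Module.finrank ℂ (P ⊓ LinearMap.ker L : Submodule ℂ V) + 1 := by
  have h1 := LinearMap.finrank_range_add_finrank_ker (L.domRestrict P)
  have h2 : Module.finrank ℂ (LinearMap.range (L.domRestrict P)) ≤ 1 := by
    simpa using Submodule.finrank_le (LinearMap.range (L.domRestrict P))
  have h3 : Module.finrank ℂ (P ⊓ LinearMap.ker L : Submodule ℂ V) =
      Module.finrank ℂ (LinearMap.ker (L.domRestrict P)) := by
    have : (P ⊓ LinearMap.ker L : Submodule ℂ V) = (LinearMap.ker (L.domRestrict P)).map P.subtype := by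
      ext x; simp [and_comm]
    rw [this]; exact Submodule.finrank_map_subtype_eq _ _
  omega

lemma SmCub.nd2 (h : SmCub T) (hV : Module.finrank ℂ V = 4) {P : Submodule ℂ V}
    (hP : Module.finrank ℂ P = 3) {L₁ L₂ L₃ : V →ₗ[ℂ] ℂ}
    (hF : ∀ x ∈ P, T x x x = L₁ x * L₂ x * L₃ x)
    (hL : P ⊓ LinearMap.ker L₁ ≤ LinearMap.ker L₂) : False := by
  have := finrank_inf_ker_ge P L₁
  refine h.nd hV hP (N := P ⊓ LinearMap.ker L₁) (by omega) fun x hx y hy => ?_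
  have hx1 : L₁ x = 0 := hx.2
  have hx2 : L₂ x = 0 := hL hx
  have h1 := h.cube_add x y
  have h2 := h.cube_add x (-y)
  rw [hF _ (P.add_mem hx.1 hy), hF _ hx.1, hF _ hy] at h1
  rw [hF _ (P.add_mem hx.1 (P.neg_mem hy)), hF _ hx.1, hF _ (P.neg_mem hy)] at h2
  simp only [map_neg, LinearMap.neg_apply, map_add, hx1, hx2] at h1 h2
  linear_combination (-1/6) * h1 + (1/6) * h2

structure Tri (T : V →ₗ[ℂ] V →ₗ[ℂ] V →ₗ[ℂ] ℂ) (P W₁ W₂ W₃ : Submodule ℂ V) : Prop where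
  fr : Module.finrank ℂ P = 3
  l1 : IsLn T W₁
  l2 : IsLn T W₂
  l3 : IsLn T W₃
  le1 : W₁ ≤ P
  le2 : W₂ ≤ P
  le3 : W₃ ≤ P
  n12 : W₁ ≠ W₂
  n13 : W₁ ≠ W₃
  n23 : W₂ ≠ W₃
  pt : ∀ x ∈ P, T x x x = 0 → x ∈ W₁ ∨ x ∈ W₂ ∨ x ∈ W₃
  ln : ∀ W ≤ P, IsLn T W → W = W₁ ∨ W = W₂ ∨ W = W₃

lemma finrank_inf_ker_eq {P : Submodule ℂ V} (L : V →ₗ[ℂ] ℂ) (hP : Module.finrank ℂ P = 3)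
    (h : ¬ P ≤ LinearMap.ker L) : Module.finrank ℂ (P ⊓ LinearMap.ker L : Submodule ℂ V) = 2 := by
  have h1 := finrank_inf_ker_ge P L
  have h2 : P ⊓ LinearMap.ker L < P := lt_of_le_of_ne inf_le_left fun he => h (by
    rw [← he]; exact inf_le_right)
  have := Submodule.finrank_lt_finrank_of_lt h2
  omega

lemma SmCub.tri (h : SmCub T) (hV : Module.finrank ℂ V = 4) {P : Submodule ℂ V}
    (hP : Module.finrank ℂ P = 3) {L₁ L₂ L₃ : V →ₗ[ℂ] ℂ}
    (hF : ∀ x ∈ P, T x x x = L₁ x * L₂ x * L₃ x) :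
    Tri T P (P ⊓ LinearMap.ker L₁) (P ⊓ LinearMap.ker L₂) (P ⊓ LinearMap.ker L₃) := by
  have n12 : ¬ P ⊓ LinearMap.ker L₁ ≤ LinearMap.ker L₂ := fun hh => h.nd2 hV hP hF hh
  have n13 : ¬ P ⊓ LinearMap.ker L₁ ≤ LinearMap.ker L₃ := fun hh =>
    h.nd2 hV hP (L₁ := L₁) (L₂ := L₃) (L₃ := L₂) (fun x hx => by rw [hF x hx]; ring) hh
  have n21 : ¬ P ⊓ LinearMap.ker L₂ ≤ LinearMap.ker L₁ := fun hh =>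
    h.nd2 hV hP (L₁ := L₂) (L₂ := L₁) (L₃ := L₃) (fun x hx => by rw [hF x hx]; ring) hh
  have n23 : ¬ P ⊓ LinearMap.ker L₂ ≤ LinearMap.ker L₃ := fun hh =>
    h.nd2 hV hP (L₁ := L₂) (L₂ := L₃) (L₃ := L₁) (fun x hx => by rw [hF x hx]; ring) hh
  have f1 := finrank_inf_ker_eq L₁ hP fun hh => n21 (inf_le_left.trans hh)
  have f2 := finrank_inf_ker_eq L₂ hP fun hh => n12 (inf_le_left.trans hh)
  have f3 := finrank_inf_ker_eq L₃ hP fun hh => n13 (inf_le_left.trans hh)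
  refine ⟨hP, ⟨f1, ?_⟩, ⟨f2, ?_⟩, ⟨f3, ?_⟩, inf_le_left, inf_le_left, inf_le_left, ?_, ?_, ?_, ?_, ?_⟩
  · rintro x ⟨hx, hx'⟩
    rw [hF x hx, LinearMap.mem_ker.1 hx']; ring
  · rintro x ⟨hx, hx'⟩
    rw [hF x hx, LinearMap.mem_ker.1 hx']; ring
  · rintro x ⟨hx, hx'⟩
    rw [hF x hx, LinearMap.mem_ker.1 hx']; ring
  · intro he; exact n12 (he.le.trans inf_le_right)
  · intro he; exact n13 (he.le.trans inf_le_right)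
  · intro he; exact n23 (he.le.trans inf_le_right)
  · intro x hx h0
    rw [hF x hx] at h0
    simp only [mul_eq_zero] at h0
    simp only [Submodule.mem_inf, hx, LinearMap.mem_ker, true_and]
    tauto
  · intro W hW hl
    have key : W ≤ LinearMap.ker L₁ ∨ W ≤ LinearMap.ker L₂ ∨ W ≤ LinearMap.ker L₃ := by
      by_contra hc
      push Not at hc
      obtain ⟨x, hx, hx'⟩ := Module.Dual.exists_forall_mem_ne_zero_of_forall_exists W ![L₁, L₂, L₃] (by
        intro i
        fin_cases i
        · obtain ⟨x, hx, hx'⟩ := SetLike.not_le_iff_exists.1 hc.1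
          exact ⟨x, hx, hx'⟩
        · obtain ⟨x, hx, hx'⟩ := SetLike.not_le_iff_exists.1 hc.2.1
          exact ⟨x, hx, hx'⟩
        · obtain ⟨x, hx, hx'⟩ := SetLike.not_le_iff_exists.1 hc.2.2
          exact ⟨x, hx, hx'⟩)
      have := hl.2 x hx
      rw [hF x (hW hx)] at this
      simp only [mul_eq_zero] at this
      have a := hx' 0; have b := hx' 1; have c := hx' 2
      simp at a b c
      tauto
    rcases key with hk | hk | hk
    · exact Or.inl (Submodule.eq_of_le_of_finrank_eq (le_inf hW hk) (by rw [hl.1, f1]))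
    · exact Or.inr (Or.inl (Submodule.eq_of_le_of_finrank_eq (le_inf hW hk) (by rw [hl.1, f2])))
    · exact Or.inr (Or.inr (Submodule.eq_of_le_of_finrank_eq (le_inf hW hk) (by rw [hl.1, f3])))

lemma exists_meet {P W W' : Submodule ℂ V} (hP : Module.finrank ℂ P = 3)
    (hW : Module.finrank ℂ W = 2) (hW' : Module.finrank ℂ W' = 2) (h : W ≤ P) (h' : W' ≤ P) :
    W ⊓ W' ≠ ⊥ := by
  intro he
  have h1 := Submodule.finrank_sup_add_finrank_inf_eq W W'
  rw [he, finrank_bot] at h1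
  have := Submodule.finrank_mono (sup_le h h')
  omega
end Core

section Lines
variable {V : Type*} [AddCommGroup V] [Module ℂ V]
variable {T : V →ₗ[ℂ] V →ₗ[ℂ] V →ₗ[ℂ] ℂ}

/-- determinant of a symmetric matrix -/
def dt (a b c d e f : ℂ) : ℂ := a * c * f + 2 * b * d * e - a * e ^ 2 - c * d ^ 2 - b ^ 2 * f

lemma fact_aux (a b c d e f : ℂ) (h : dt a b c d e f = 0) (ha : a ≠ 0) :
    ∃ l m : Fin 3 → ℂ, a = l 0 * m 0 ∧ c = l 1 * m 1 ∧ f = l 2 * m 2 ∧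
      2 * b = l 0 * m 1 + l 1 * m 0 ∧ 2 * d = l 0 * m 2 + l 2 * m 0 ∧
      2 * e = l 1 * m 2 + l 2 * m 1 := by
  obtain ⟨p, q, hp, hq, hpq⟩ : ∃ p q : ℂ, p ^ 2 = b ^ 2 - a * c ∧ q ^ 2 = d ^ 2 - a * f ∧
      p * q = b * d - a * e := by
    obtain ⟨p, hp⟩ := IsAlgClosed.exists_pow_nat_eq (b ^ 2 - a * c) (n := 2) (by norm_num)
    have hdisc : (b * d - a * e) ^ 2 = (b ^ 2 - a * c) * (d ^ 2 - a * f) := by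
      unfold dt at h; linear_combination -a * h
    by_cases hp0 : p = 0
    · obtain ⟨q, hq⟩ := IsAlgClosed.exists_pow_nat_eq (d ^ 2 - a * f) (n := 2) (by norm_num)
      refine ⟨p, q, hp, hq, ?_⟩
      rw [← hp, hp0] at hdisc
      have : b * d - a * e = 0 := by
        have : (b * d - a * e) ^ 2 = 0 := by rw [hdisc]; ring
        exact pow_eq_zero_iff (two_ne_zero) |>.1 this
      rw [this, hp0]; ring
    · refine ⟨p, (b * d - a * e) / p, hp, ?_, ?_⟩
      · rw [div_pow, hdisc, ← hp]; field_simp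
      · field_simp
  refine ⟨![a, b + p, d + q], ![1, (b - p) / a, (d - q) / a], ?_⟩
  simp only [Matrix.cons_val_zero, Matrix.cons_val_one, Matrix.cons_val]
  refine ⟨by ring, ?_, ?_, ?_, ?_, ?_⟩
  · field_simp; linear_combination hp
  · field_simp; linear_combination hq
  · field_simp; ring
  · field_simp; ring
  · field_simp; linear_combination 2 * hpq

lemma fact (a b c d e f : ℂ) (h : dt a b c d e f = 0) :
    ∃ l m : Fin 3 → ℂ, a = l 0 * m 0 ∧ c = l 1 * m 1 ∧ f = l 2 * m 2 ∧
      2 * b = l 0 * m 1 + l 1 * m 0 ∧ 2 * d = l 0 * m 2 + l 2 * m 0 ∧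
      2 * e = l 1 * m 2 + l 2 * m 1 := by
  by_cases ha : a = 0
  swap
  · exact fact_aux a b c d e f h ha
  by_cases hc : c = 0
  swap
  · obtain ⟨l, m, h1, h2, h3, h4, h5, h6⟩ := fact_aux c b a e d f (by rw [← h]; unfold dt; ring) hc
    refine ⟨![l 1, l 0, l 2], ![m 1, m 0, m 2], ?_⟩
    simp only [Matrix.cons_val_zero, Matrix.cons_val_one, Matrix.cons_val]
    exact ⟨h2, h1, h3, by rw [h4]; ring, h6, h5⟩
  by_cases hf : f = 0
  swap
  · obtain ⟨l, m, h1, h2, h3, h4, h5, h6⟩ := fact_aux f e c d b a (by rw [← h]; unfold dt; ring) hf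
    refine ⟨![l 2, l 1, l 0], ![m 2, m 1, m 0], ?_⟩
    simp only [Matrix.cons_val_zero, Matrix.cons_val_one, Matrix.cons_val]
    exact ⟨h3, h2, h1, by rw [h6]; ring, by rw [h5]; ring, by rw [h4]; ring⟩
  subst ha hc hf
  have : b = 0 ∨ d = 0 ∨ e = 0 := by
    have : b * d * e = 0 := by unfold dt at h; linear_combination h / 2
    simpa [or_assoc] using this
  rcases this with rfl | rfl | rfl
  · refine ⟨![0, 0, 2], ![d, e, 0], ?_⟩
    simp
  · refine ⟨![0, 2, 0], ![b, 0, e], ?_⟩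
    simp
  · refine ⟨![2, 0, 0], ![0, b, d], ?_⟩
    simp

/-- the discriminant of the residual conic in the plane through `e0, e1, u` -/
noncomputable def Dl (T : V →ₗ[ℂ] V →ₗ[ℂ] V →ₗ[ℂ] ℂ) (e0 e1 u : V) : ℂ :=
  dt (T e0 e0 u) (T e0 e1 u) (T e1 e1 u) (T e0 u u / 2) (T e1 u u / 2) (T u u u / 3)

structure Adapted (T : V →ₗ[ℂ] V →ₗ[ℂ] V →ₗ[ℂ] ℂ) (e0 e1 : V) : Prop where
  v000 : T e0 e0 e0 = 0
  v001 : T e0 e0 e1 = 0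
  v011 : T e0 e1 e1 = 0
  v111 : T e1 e1 e1 = 0

/-- expansion of the cubic -/
lemma SmCub.expand3 (h : SmCub T) (x y z : V) :
    T (x + y + z) (x + y + z) (x + y + z) = T x x x + T y y y + T z z z + 3 * T x x y + 3 * T x x z
      + 3 * T x y y + 3 * T y y z + 3 * T x z z + 3 * T y z z + 6 * T x y z := by
  rw [h.cube_add, h.cube_add, h.sq_add]
  simp only [map_add, LinearMap.add_apply]
  ring

lemma SmCub.sq3 (h : SmCub T) (x y z w : V) :
    T (x + y + z) (x + y + z) w = T x x w + T y y w + T z z w + 2 * T x y w + 2 * T x z w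
      + 2 * T y z w := by
  rw [h.sq_add, h.sq_add]
  simp only [map_add, LinearMap.add_apply]
  ring

lemma SmCub.cubic_plane (h : SmCub T) {e0 e1 : V} (hA : Adapted T e0 e1) (u : V) (x y z : ℂ) :
    T (x • e0 + y • e1 + z • u) (x • e0 + y • e1 + z • u) (x • e0 + y • e1 + z • u) =
    3 * z * (T e0 e0 u * x ^ 2 + 2 * T e0 e1 u * x * y + T e1 e1 u * y ^ 2
      + T e0 u u * x * z + T e1 u u * y * z + T u u u / 3 * z ^ 2) := by
  rw [h.expand3]
  simp only [map_smul, LinearMap.smul_apply, smul_eq_mul, hA.v000, hA.v001, hA.v011, hA.v111]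
  ring

/-- scaling and translation behaviour -/
lemma SmCub.Dl_trans (h : SmCub T) {e0 e1 : V} (hA : Adapted T e0 e1) (u : V) (x y z : ℂ) :
    Dl T e0 e1 (x • e0 + y • e1 + z • u) = z ^ 5 * Dl T e0 e1 u := by
  have k1 : ∀ w, T w (x • e0 + y • e1 + z • u) (x • e0 + y • e1 + z • u) =
     x ^ 2 * T e0 e0 w + y ^ 2 * T e1 e1 w + z ^ 2 * T w u u + 2 * x * y * T e0 e1 w +
     2 * x * z * T e0 w u + 2 * y * z * T e1 w u := by
    intro w
    rw [h.s13, h.sq3]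
    simp only [map_smul, LinearMap.smul_apply, smul_eq_mul]
    rw [h.s13 u u w, h.s23 e0 u w, h.s23 e1 u w]
    ring
  unfold Dl
  rw [h.cubic_plane hA, k1, k1]
  simp only [map_add, map_smul, LinearMap.add_apply, LinearMap.smul_apply, smul_eq_mul, hA.v000, hA.v001, hA.v011, hA.v111, h.s12 e1 e0, h.s23 e0 e1 e0, h.s13 e1 e1 e0]
  unfold dt
  ring

/-- a line through a point of `ℓ` gives a root -/
lemma SmCub.Dl_root (h : SmCub T) {e0 e1 : V} (u : V) (x y : ℂ)
    (hxy : x ≠ 0 ∨ y ≠ 0)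
    (h1 : T (x • e0 + y • e1) (x • e0 + y • e1) u = 0) (h2 : T (x • e0 + y • e1) u u = 0)
    (h3 : T u u u = 0) : Dl T e0 e1 u = 0 := by
  rw [h.sq_add] at h1
  simp only [map_add, map_smul, LinearMap.add_apply, LinearMap.smul_apply, smul_eq_mul] at h1 h2
  unfold Dl dt
  rw [h3]
  set a := T e0 e0 u
  set b := T e0 e1 u
  set c := T e1 e1 u
  set d := T e0 u u
  set e := T e1 u u
  rcases hxy with hx | hx
  · have : x ^ 2 * (2 * b * d * e - a * e ^ 2 - c * d ^ 2) = 0 := by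
      linear_combination (-e ^ 2) * h1 + (2 * b * e * x - c * d * x + c * e * y) * h2
    have := (mul_eq_zero.1 this).resolve_left (pow_ne_zero _ hx)
    linear_combination this / 4
  · have : y ^ 2 * (2 * b * d * e - a * e ^ 2 - c * d ^ 2) = 0 := by
      linear_combination (-d ^ 2) * h1 + (2 * b * d * y - a * e * y + a * d * x) * h2
    have := (mul_eq_zero.1 this).resolve_left (pow_ne_zero _ hx)
    linear_combination this / 4

/-- derivative of the discriminant -/
noncomputable def Dl' (T : V →ₗ[ℂ] V →ₗ[ℂ] V →ₗ[ℂ] ℂ) (e0 e1 u u' : V) : ℂ :=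
  let a := T e0 e0 u; let b := T e0 e1 u; let c := T e1 e1 u
  let d := T e0 u u / 2; let e := T e1 u u / 2; let f := T u u u / 3
  let a' := T e0 e0 u'; let b' := T e0 e1 u'; let c' := T e1 e1 u'
  let d' := T e0 u u'; let e' := T e1 u u'; let f' := T u u u'
  a' * (c * f - e ^ 2) + c' * (a * f - d ^ 2) + f' * (a * c - b ^ 2)
    + 2 * b' * (d * e - b * f) + 2 * d' * (b * e - c * d) + 2 * e' * (b * d - a * e)

variable [FiniteDimensional ℂ V]

lemma SmCub.plane (h : SmCub T) (b : Module.Basis (Fin 4) ℂ V) (hA : Adapted T (b 0) (b 1)) (w : ℂ)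
    (hD : Dl T (b 0) (b 1) (b 2 + w • b 3) = 0) :
    (∃ W₂ W₃, Tri T (LinearMap.ker (b.coord 3 - w • b.coord 2))
      (LinearMap.ker (b.coord 2) ⊓ LinearMap.ker (b.coord 3)) W₂ W₃) ∧
    Dl' T (b 0) (b 1) (b 2 + w • b 3) (b 3) ≠ 0 := by
  have hV : Module.finrank ℂ V = 4 := by simpa using Module.finrank_eq_card_basis b
  set u := b 2 + w • b 3 with hu
  set P := LinearMap.ker (b.coord 3 - w • b.coord 2) with hPdef
  have hP : Module.finrank ℂ P = 3 := by
    have h1 := finrank_inf_ker_ge ⊤ (b.coord 3 - w • b.coord 2)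
    rw [top_inf_eq, finrank_top, ← hPdef] at h1
    have h2 : P < ⊤ := by
      rw [lt_top_iff_ne_top]
      intro he
      have : b 3 ∈ P := by rw [he]; trivial
      simp [hPdef] at this
    have := Submodule.finrank_lt_finrank_of_lt h2
    rw [finrank_top] at this
    omega
  obtain ⟨l, m, k1, k2, k3, k4, k5, k6⟩ := fact _ _ _ _ _ _ hD
  have hdec : ∀ x ∈ P, x = b.coord 0 x • b 0 + b.coord 1 x • b 1 + b.coord 2 x • u := by
    intro x hx
    have hx' : b.coord 3 x = w * b.coord 2 x := by
      have := LinearMap.mem_ker.1 hx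
      simp only [LinearMap.sub_apply, LinearMap.smul_apply, smul_eq_mul] at this
      linear_combination this
    have := b.sum_repr x
    rw [Fin.sum_univ_four] at this
    simp only [Module.Basis.coord_apply] at hx' ⊢
    rw [hx'] at this
    conv_lhs => rw [← this]
    rw [hu]; module
  set L : (Fin 3 → ℂ) → V →ₗ[ℂ] ℂ := fun l => l 0 • b.coord 0 + l 1 • b.coord 1 + l 2 • b.coord 2
  have hF : ∀ x ∈ P, T x x x = ((3 : ℂ) • b.coord 2) x * L l x * L m x := by
    intro x hx
    conv_lhs => rw [hdec x hx]
    rw [h.cubic_plane hA]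
    simp only [L, LinearMap.add_apply, LinearMap.smul_apply, smul_eq_mul]
    linear_combination (3 * b.coord 2 x) * (k1 * b.coord 0 x ^ 2 + k4 * b.coord 0 x * b.coord 1 x
      + k2 * b.coord 1 x ^ 2 + k5 * b.coord 0 x * b.coord 2 x + k6 * b.coord 1 x * b.coord 2 x
      + k3 * b.coord 2 x ^ 2)
  have htri := h.tri hV hP hF
  constructor
  · refine ⟨P ⊓ LinearMap.ker (L l), P ⊓ LinearMap.ker (L m), ?_⟩
    convert htri using 1
    ext x
    simp only [Submodule.mem_inf, LinearMap.mem_ker, hPdef, LinearMap.sub_apply, LinearMap.smul_apply, smul_eq_mul]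
    constructor
    · rintro ⟨h1, h2⟩; simp [h1, h2]
    · rintro ⟨h1, h2⟩
      have h2 : b.coord 2 x = 0 := by simpa using h2
      rw [h2] at h1
      exact ⟨h2, by simpa using h1⟩
  · set v : Fin 3 → ℂ := ![l 1 * m 2 - l 2 * m 1, l 2 * m 0 - l 0 * m 2, l 0 * m 1 - l 1 * m 0] with hv
    have hv0 : v ≠ 0 := by
      have hcr : crossProduct l m = v := by rw [cross_apply]
      rw [← hcr, crossProduct_ne_zero_iff_linearIndependent]
      by_contra hli
      rw [LinearIndependent.pair_iff] at hli
      push Not at hli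
      obtain ⟨s, t, hst, hst0⟩ := hli
      have hL : ∀ x, s * L l x + t * L m x = 0 := by
        intro x
        have c0 := congrFun hst 0; have c1 := congrFun hst 1; have c2 := congrFun hst 2
        simp only [Pi.add_apply, Pi.smul_apply, smul_eq_mul, Pi.zero_apply] at c0 c1 c2
        simp only [L, LinearMap.add_apply, LinearMap.smul_apply, smul_eq_mul]
        linear_combination b.coord 0 x * c0 + b.coord 1 x * c1 + b.coord 2 x * c2
      by_cases hs : s = 0
      · have ht := hst0 hs
        refine h.nd2 hV hP (L₁ := L l) (L₂ := L m) (L₃ := ((3 : ℂ) • b.coord 2)) (fun x hx => by rw [hF x hx]; ring) ?_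
        rintro x ⟨-, -⟩
        have := hL x
        rw [hs] at this
        simpa [ht] using this
      · refine h.nd2 hV hP (L₁ := L m) (L₂ := L l) (L₃ := ((3 : ℂ) • b.coord 2)) (fun x hx => by rw [hF x hx]; ring) ?_
        rintro x ⟨-, hx⟩
        have := hL x
        rw [LinearMap.mem_ker.1 hx] at this
        simpa [hs] using this
    set p : V := v 0 • b 0 + v 1 • b 1 + v 2 • u with hp
    have hp0 : p ≠ 0 := by
      intro h0
      have e0 : b.coord 0 p = v 0 := by simp [hp, hu]
      have e1 : b.coord 1 p = v 1 := by simp [hp, hu]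
      have e2 : b.coord 2 p = v 2 := by simp [hp, hu]
      rw [h0, map_zero] at e0 e1 e2
      apply hv0
      ext i; fin_cases i
      · exact e0.symm
      · exact e1.symm
      · exact e2.symm
    have hv0' : v 0 = l 1 * m 2 - l 2 * m 1 := rfl
    have hv1' : v 1 = l 2 * m 0 - l 0 * m 2 := rfl
    have hv2' : v 2 = l 0 * m 1 - l 1 * m 0 := rfl
    have q3 : T p p (b 3) = -4 * Dl' T (b 0) (b 1) u (b 3) := by
      rw [hp, h.sq3]
      simp only [map_smul, LinearMap.smul_apply, smul_eq_mul]
      have k4' : T (b 0) (b 1) u = (l 0 * m 1 + l 1 * m 0) / 2 := by linear_combination k4 / 2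
      have k5' : T (b 0) u u / 2 = (l 0 * m 2 + l 2 * m 0) / 2 := by linear_combination k5 / 2
      have k6' : T (b 1) u u / 2 = (l 1 * m 2 + l 2 * m 1) / 2 := by linear_combination k6 / 2
      simp only [Dl']
      rw [k1, k2, k3, k4', k5', k6', hv0', hv1', hv2']
      ring
    have k5' : T (b 0) u u = (l 0 * m 2 + l 2 * m 0) := by linear_combination k5
    have k6' : T (b 1) u u  = (l 1 * m 2 + l 2 * m 1)  := by linear_combination k6
    have k4' : T (b 0) (b 1) u = (l 0 * m 1 + l 1 * m 0) / 2 := by linear_combination k4 / 2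
    have k3' : T u u u = 3 * (l 2 * m 2) := by linear_combination 3 * k3
    have q0 : T p p (b 0) = 0 := by
      rw [hp, h.sq3]
      simp only [map_smul, LinearMap.smul_apply, smul_eq_mul]
      rw [h.s23 (b 0) u (b 0), h.s13 u u (b 0), h.s13 (b 1) u (b 0), h.s23 (b 0) u (b 1), h.s23 (b 0) (b 1) (b 0), h.s13 (b 1) (b 1) (b 0),
        hA.v000, hA.v001, hA.v011, k1, k5', k4', hv0', hv1', hv2']
      ring
    have q1 : T p p (b 1) = 0 := by
      rw [hp, h.sq3]
      simp only [map_smul, LinearMap.smul_apply, smul_eq_mul]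
      rw [h.s23 (b 1) u (b 1), h.s13 u u (b 1), h.s23 (b 0) u (b 1),
        hA.v111, hA.v001, hA.v011, k2, k6', k4', hv0', hv1', hv2']
      ring
    have q2 : T p p u = 0 := by
      rw [hp, h.sq3]
      simp only [map_smul, LinearMap.smul_apply, smul_eq_mul]
      rw [k1, k2, k3', k4', k5', k6', hv0', hv1', hv2']
      ring
    intro hz
    rw [hz, mul_zero] at q3
    obtain ⟨y, hy⟩ := h.sm p hp0
    apply hy
    rw [← b.sum_repr y, Fin.sum_univ_four]
    have q2' : T p p (b 2) = 0 := by
      have : b 2 = u - w • b 3 := by rw [hu]; simp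
      rw [this]; simp [q2, q3]
    simp [q0, q1, q2', q3]

end Lines

section Count
variable {V : Type*} [AddCommGroup V] [Module ℂ V]
variable {T : V →ₗ[ℂ] V →ₗ[ℂ] V →ₗ[ℂ] ℂ}

/-- the quintic -/
noncomputable def quint (a0 a1 b0 b1 c0 c1 d0 d1 d2 e0 e1 e2 f0 f1 f2 f3 : ℂ) : Polynomial ℂ :=
  let a : Polynomial ℂ := .C a0 + .C a1 * .X
  let b : Polynomial ℂ := .C b0 + .C b1 * .X
  let c : Polynomial ℂ := .C c0 + .C c1 * .X
  let d : Polynomial ℂ := .C d0 + .C d1 * .X + .C d2 * .X ^ 2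
  let e : Polynomial ℂ := .C e0 + .C e1 * .X + .C e2 * .X ^ 2
  let f : Polynomial ℂ := .C f0 + .C f1 * .X + .C f2 * .X ^ 2 + .C f3 * .X ^ 3
  a * c * f + 2 * b * d * e - a * e ^ 2 - c * d ^ 2 - b ^ 2 * f

lemma quint_natDegree (a0 a1 b0 b1 c0 c1 d0 d1 d2 e0 e1 e2 f0 f1 f2 f3 : ℂ)
    (h : dt a1 b1 c1 d2 e2 f3 ≠ 0) :
    (quint a0 a1 b0 b1 c0 c1 d0 d1 d2 e0 e1 e2 f0 f1 f2 f3).natDegree = 5 := by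
  have key : quint a0 a1 b0 b1 c0 c1 d0 d1 d2 e0 e1 e2 f0 f1 f2 f3 = .C (dt a1 b1 c1 d2 e2 f3) * .X ^ 5
      + .C ((1) * a0 * c1 * f3 + (-1) * a0 * e2 * e2 + (1) * a1 * c0 * f3 + (1) * a1 * c1 * f2 + (-2) * a1 * e1 * e2 + (-2) * b0 * b1 * f3 + (2) * b0 * d2 * e2 + (-1) * b1 * b1 * f2 + (2) * b1 * d1 * e2 + (2) * b1 * d2 * e1 + (-1) * c0 * d2 * d2 + (-2) * c1 * d1 * d2) * .X ^ 4
      + .C ((1) * a0 * c0 * f3 + (1) * a0 * c1 * f2 + (-2) * a0 * e1 * e2 + (1) * a1 * c0 * f2 + (1) * a1 * c1 * f1 + (-2) * a1 * e0 * e2 + (-1) * a1 * e1 * e1 + (-1) * b0 * b0 * f3 + (-2) * b0 * b1 * f2 + (2) * b0 * d1 * e2 + (2) * b0 * d2 * e1 + (-1) * b1 * b1 * f1 + (2) * b1 * d0 * e2 + (2) * b1 * d1 * e1 + (2) * b1 * d2 * e0 + (-2) * c0 * d1 * d2 + (-2) * c1 * d0 * d2 + (-1) * c1 * d1 * d1)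 * .X ^ 3
      + .C ((1) * a0 * c0 * f2 + (1) * a0 * c1 * f1 + (-2) * a0 * e0 * e2 + (-1) * a0 * e1 * e1 + (1) * a1 * c0 * f1 + (1) * a1 * c1 * f0 + (-2) * a1 * e0 * e1 + (-1) * b0 * b0 * f2 + (-2) * b0 * b1 * f1 + (2) * b0 * d0 * e2 + (2) * b0 * d1 * e1 + (2) * b0 * d2 * e0 + (-1) * b1 * b1 * f0 + (2) * b1 * d0 * e1 + (2) * b1 * d1 * e0 + (-2) * c0 * d0 * d2 + (-1) * c0 * d1 * d1 + (-2) * c1 * d0 * d1) * .X ^ 2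
      + .C ((1) * a0 * c0 * f1 + (1) * a0 * c1 * f0 + (-2) * a0 * e0 * e1 + (1) * a1 * c0 * f0 + (-1) * a1 * e0 * e0 + (-1) * b0 * b0 * f1 + (-2) * b0 * b1 * f0 + (2) * b0 * d0 * e1 + (2) * b0 * d1 * e0 + (2) * b1 * d0 * e0 + (-2) * c0 * d0 * d1 + (-1) * c1 * d0 * d0) * .X ^ 1
      + .C ((1) * a0 * c0 * f0 + (-1) * a0 * e0 * e0 + (-1) * b0 * b0 * f0 + (2) * b0 * d0 * e0 + (-1) * c0 * d0 * d0) * .X ^ 0 := by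
    unfold quint dt
    simp only [map_add, map_mul, map_sub, map_pow, map_neg, map_ofNat, map_one]
    ring
  rw [key]
  compute_degree!

lemma roots_card (p : Polynomial ℂ) (hp : p.natDegree = 5)
    (h : ∀ w, p.eval w = 0 → (Polynomial.derivative p).eval w ≠ 0) : p.roots.toFinset.card = 5 := by
  have hp0 : p ≠ 0 := by rintro rfl; simp at hp
  rw [Multiset.toFinset_card_of_nodup]
  · rw [← hp]; exact IsAlgClosed.card_roots_eq_natDegree
  · rw [Multiset.nodup_iff_count_le_one]
    intro w
    rw [Polynomial.count_roots]
    by_contra hc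
    push Not at hc
    have := (Polynomial.one_lt_rootMultiplicity_iff_isRoot hp0).1 hc
    exact h w this.1 this.2

/-- the quintic of a basis -/
noncomputable def bq (T : V →ₗ[ℂ] V →ₗ[ℂ] V →ₗ[ℂ] ℂ) (b : Module.Basis (Fin 4) ℂ V) : Polynomial ℂ :=
  quint (T (b 0) (b 0) (b 2)) (T (b 0) (b 0) (b 3)) (T (b 0) (b 1) (b 2)) (T (b 0) (b 1) (b 3))
    (T (b 1) (b 1) (b 2)) (T (b 1) (b 1) (b 3))
    (T (b 0) (b 2) (b 2) / 2) (T (b 0) (b 2) (b 3)) (T (b 0) (b 3) (b 3) / 2)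
    (T (b 1) (b 2) (b 2) / 2) (T (b 1) (b 2) (b 3)) (T (b 1) (b 3) (b 3) / 2)
    (T (b 2) (b 2) (b 2) / 3) (T (b 2) (b 2) (b 3)) (T (b 2) (b 3) (b 3)) (T (b 3) (b 3) (b 3) / 3)

lemma SmCub.bq_eval (h : SmCub T) (b : Module.Basis (Fin 4) ℂ V) (w : ℂ) :
    (bq T b).eval w = Dl T (b 0) (b 1) (b 2 + w • b 3) := by
  unfold bq quint Dl dt
  rw [h.cube_add]
  simp only [map_add, map_smul, LinearMap.add_apply, LinearMap.smul_apply, smul_eq_mul,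
    h.s23 _ (b 3) (b 2)]
  simp
  ring

lemma SmCub.bq_deriv (h : SmCub T) (b : Module.Basis (Fin 4) ℂ V) (w : ℂ) :
    (Polynomial.derivative (bq T b)).eval w = Dl' T (b 0) (b 1) (b 2 + w • b 3) (b 3) := by
  unfold bq quint Dl'
  rw [h.cube_add, h.sq_add]
  simp only [map_add, map_smul, LinearMap.add_apply, LinearMap.smul_apply, smul_eq_mul,
    h.s23 _ (b 3) (b 2)]
  simp [Polynomial.derivative_pow]
  ring

lemma SmCub.adapted (h : SmCub T) {W : Submodule ℂ V} (hW : IsLn T W) {x y : V} (hx : x ∈ W) (hy : y ∈ W) :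
    Adapted T x y :=
  ⟨h.polar3 hW.2 hx hx hx, h.polar3 hW.2 hx hx hy, h.polar3 hW.2 hx hy hy, h.polar3 hW.2 hy hy hy⟩

variable [FiniteDimensional ℂ V]

lemma exists_basis {W : Submodule ℂ V} (hV : Module.finrank ℂ V = 4)
    (hW : Module.finrank ℂ W = 2) : ∃ b : Module.Basis (Fin 4) ℂ V, b 0 ∈ W ∧ b 1 ∈ W := by
  obtain ⟨W', hW'⟩ := W.exists_isCompl
  have h2 : Module.finrank ℂ W' = 2 := by
    have := Submodule.finrank_add_eq_of_isCompl hW'; omega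
  let b1 := Module.finBasisOfFinrankEq ℂ W hW
  let b2 := Module.finBasisOfFinrankEq ℂ W' h2
  let e : Fin 2 ⊕ Fin 2 ≃ Fin 4 := finSumFinEquiv
  let b := ((b1.prod b2).map (Submodule.prodEquivOfIsCompl W W' hW')).reindex e
  refine ⟨b, ?_, ?_⟩
  · have : b 0 = b1 0 := by
      have : (0 : Fin 4) = e (Sum.inl (0 : Fin 2)) := rfl
      rw [this]; simp [b]
    rw [this]; exact (b1 0).2
  · have : b 1 = b1 1 := by
      have : (1 : Fin 4) = e (Sum.inl (1 : Fin 2)) := rfl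
      rw [this]; simp [b]
    rw [this]; exact (b1 1).2

lemma SmCub.exists_good_basis (h : SmCub T) {W : Submodule ℂ V} (hV : Module.finrank ℂ V = 4)
    (hW : IsLn T W) : ∃ b : Module.Basis (Fin 4) ℂ V, b 0 ∈ W ∧ b 1 ∈ W ∧ Dl T (b 0) (b 1) (b 3) ≠ 0 := by
  obtain ⟨b, h0, h1⟩ := exists_basis hV hW.1
  have hA := h.adapted hW h0 h1
  obtain ⟨w, hw⟩ : ∃ w, Dl T (b 0) (b 1) (b 2 + w • b 3) ≠ 0 := by
    by_contra hc
    push Not at hc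
    have hb0 : bq T b = 0 := Polynomial.funext fun w => by rw [h.bq_eval, hc w]; simp
    apply (h.plane b hA 0 (hc 0)).2
    rw [← h.bq_deriv, hb0]; simp
  have hli : LinearIndependent ℂ ![b 0, b 1, b 3, b 2 + w • b 3] := by
    rw [Fintype.linearIndependent_iff]
    intro g hg
    simp only [Fin.sum_univ_four, Matrix.cons_val_zero, Matrix.cons_val_one, Matrix.cons_val] at hg
    have e0 := congrArg (b.coord 0) hg
    have e1 := congrArg (b.coord 1) hg
    have e2 := congrArg (b.coord 2) hg
    have e3 := congrArg (b.coord 3) hg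
    simp at e0 e1 e2 e3
    intro i; fin_cases i
    · exact e0
    · exact e1
    · simpa [e2] using e3
    · exact e2
  let b' := basisOfLinearIndependentOfCardEqFinrank hli (by simp [hV])
  have hb' : ∀ i, b' i = ![b 0, b 1, b 3, b 2 + w • b 3] i := fun i => by simp [b']
  refine ⟨b', ?_, ?_, ?_⟩
  · rw [hb']; exact h0
  · rw [hb']; exact h1
  · rw [hb', hb', hb']; exact hw

lemma line_eq_ker {W : Submodule ℂ V} (hV : Module.finrank ℂ V = 4)
    (hW : Module.finrank ℂ W = 2) (b : Module.Basis (Fin 4) ℂ V) (h0 : b 0 ∈ W) (h1 : b 1 ∈ W) :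
    LinearMap.ker (b.coord 2) ⊓ LinearMap.ker (b.coord 3) = W := by
  have k1 := finrank_inf_ker_ge (LinearMap.ker (b.coord 2)) (b.coord 3)
  have k2 := finrank_inf_ker_ge ⊤ (b.coord 2)
  rw [top_inf_eq, finrank_top] at k2
  apply Submodule.eq_of_le_of_finrank_le
  · rintro x ⟨hx, hx'⟩
    rw [SetLike.mem_coe, LinearMap.mem_ker, Module.Basis.coord_apply] at hx hx'
    rw [← b.sum_repr x, Fin.sum_univ_four, hx, hx']
    simp only [zero_smul, add_zero]
    exact W.add_mem (W.smul_mem _ h0) (W.smul_mem _ h1)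
  · omega

/-- every line on the surface meets exactly ten others -/
lemma SmCub.meets (h : SmCub T) {W : Submodule ℂ V} (hV : Module.finrank ℂ V = 4)
    (hW : IsLn T W) :
    (∃ s : Finset (Submodule ℂ V), (∀ L, L ∈ s ↔ IsLn T L ∧ L ≠ W ∧ L ⊓ W ≠ ⊥) ∧ s.card = 10) ∧
    ∃ P W₂ W₃, Tri T P W W₂ W₃ := by
  classical
  obtain ⟨b, h0, h1, hD⟩ := h.exists_good_basis hV hW
  have hA := h.adapted hW h0 h1
  have hker := line_eq_ker hV hW.1 b h0 h1
  set p := bq T b with hp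
  have hdeg : p.natDegree = 5 := quint_natDegree _ _ _ _ _ _ _ _ _ _ _ _ _ _ _ _ hD
  have hp0 : p ≠ 0 := by intro h0; rw [h0] at hdeg; simp at hdeg
  have hroot : ∀ w, p.eval w = 0 → (∃ W₂ W₃, Tri T (LinearMap.ker (b.coord 3 - w • b.coord 2))
      W W₂ W₃) ∧ (Polynomial.derivative p).eval w ≠ 0 := by
    intro w hw
    rw [hp, h.bq_eval] at hw
    rw [hp, h.bq_deriv]
    have := h.plane b hA w hw
    rwa [hker] at this
  have hcard := roots_card p hdeg fun w hw => (hroot w hw).2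
  have hmem : ∀ w, w ∈ p.roots.toFinset ↔ p.eval w = 0 := by
    intro w; simp [Polynomial.mem_roots', hp0]
  have hex : ∀ w, ∃ W₂ W₃, p.eval w = 0 → Tri T (LinearMap.ker (b.coord 3 - w • b.coord 2)) W W₂ W₃ := by
    intro w
    by_cases hw : p.eval w = 0
    · obtain ⟨W₂, W₃, ht⟩ := (hroot w hw).1
      exact ⟨W₂, W₃, fun _ => ht⟩
    · exact ⟨⊥, ⊥, fun h => absurd h hw⟩
  choose A B hAB using hex
  constructor
  · refine ⟨p.roots.toFinset.biUnion fun w => {A w, B w}, ?_, ?_⟩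
    · intro L
      simp only [Finset.mem_biUnion, Finset.mem_insert, Finset.mem_singleton, hmem]
      constructor
      · rintro ⟨w, hw, hL⟩
        have ht := hAB w hw
        rcases hL with rfl | rfl
        · exact ⟨ht.l2, ht.n12.symm, exists_meet ht.fr ht.l2.1 hW.1 ht.le2 ht.le1⟩
        · exact ⟨ht.l3, ht.n13.symm, exists_meet ht.fr ht.l3.1 hW.1 ht.le3 ht.le1⟩
      · rintro ⟨hL, hne, hmeet⟩
        obtain ⟨q, hq, hq0⟩ := (Submodule.ne_bot_iff _).1 hmeet
        obtain ⟨u, huL, huW⟩ : ∃ u ∈ L, u ∉ W := by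
          by_contra hc
          push Not at hc
          exact hne (Submodule.eq_of_le_of_finrank_eq hc (by rw [hL.1, hW.1]))
        have hqW : q ∈ LinearMap.ker (b.coord 2) ⊓ LinearMap.ker (b.coord 3) := by rw [hker]; exact hq.2
        have hq2 : b.repr q 2 = 0 := hqW.1
        have hq3 : b.repr q 3 = 0 := hqW.2
        have hqe : q = b.repr q 0 • b 0 + b.repr q 1 • b 1 := by
          conv_lhs => rw [← b.sum_repr q, Fin.sum_univ_four, hq2, hq3]
          simp
        have hDu : Dl T (b 0) (b 1) u = 0 := by
          apply h.Dl_root u (b.repr q 0) (b.repr q 1)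
          · by_contra hc
            push Not at hc
            rw [hc.1, hc.2] at hqe
            simp at hqe; exact hq0 hqe
          · rw [← hqe]; exact h.polar3 hL.2 hq.1 hq.1 huL
          · rw [← hqe]; exact h.polar3 hL.2 hq.1 huL huL
          · exact hL.2 _ huL
        have hu2 : b.repr u 2 ≠ 0 := by
          intro hu2
          have hue : u = b.repr u 0 • b 0 + b.repr u 1 • b 1 + b.repr u 3 • b 3 := by
            conv_lhs => rw [← b.sum_repr u, Fin.sum_univ_four, hu2]
            simp
          rw [hue, h.Dl_trans hA] at hDu
          have hu3 : b.repr u 3 = 0 := by simpa [hD] using hDu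
          apply huW
          rw [hue, hu3, zero_smul, add_zero]
          exact W.add_mem (W.smul_mem _ h0) (W.smul_mem _ h1)
        set w := b.repr u 3 / b.repr u 2 with hw
        have hue : u = b.repr u 0 • b 0 + b.repr u 1 • b 1 + b.repr u 2 • (b 2 + w • b 3) := by
          conv_lhs => rw [← b.sum_repr u, Fin.sum_univ_four]
          rw [smul_add, smul_smul, hw, mul_div_cancel₀ _ hu2]; module
        have hpw : p.eval w = 0 := by
          rw [hue, h.Dl_trans hA] at hDu
          rw [hp, h.bq_eval]
          simpa [hu2] using hDu
        have ht := hAB w hpw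
        refine ⟨w, hpw, ?_⟩
        have hLP : L ≤ LinearMap.ker (b.coord 3 - w • b.coord 2) := by
          have hli : LinearIndependent ℂ ![q, u] := by
            rw [LinearIndependent.pair_iff' hq0]
            intro a ha
            exact huW (by rw [← ha]; exact W.smul_mem _ hq.2)
          have hsp : Submodule.span ℂ {q, u} = L := by
            apply Submodule.eq_of_le_of_finrank_eq
            · rw [Submodule.span_le]
              rintro x (rfl | rfl)
              · exact hq.1
              · exact huL
            · rw [hL.1]
              have := finrank_span_eq_card hli
              have hr : Set.range ![q, u] = {q, u} := by simp [Matrix.range_cons, Matrix.range_empty, Set.pair_comm]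
              rw [hr] at this
              simpa using this
          rw [← hsp, Submodule.span_le]
          rintro x (rfl | rfl)
          · simp [hq2, hq3]
          · simp only [SetLike.mem_coe, LinearMap.mem_ker, LinearMap.sub_apply, LinearMap.smul_apply, Module.Basis.coord_apply, smul_eq_mul]
            rw [hw]; field_simp; simp
        exact (ht.ln L hLP hL).resolve_left hne
    · rw [Finset.card_biUnion]
      · rw [Finset.sum_congr rfl (g := fun _ => 2), Finset.sum_const, hcard]; · rfl
        intro w hw
        exact Finset.card_pair (hAB w ((hmem w).1 hw)).n23
      · intro w hw w' hw' hne
        simp only [Function.onFun]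
        rw [Finset.disjoint_left]
        have key : ∀ L, IsLn T L → L ≤ LinearMap.ker (b.coord 3 - w • b.coord 2) →
            L ≤ LinearMap.ker (b.coord 3 - w' • b.coord 2) → L = W := by
          intro L hL l1 l2
          apply Submodule.eq_of_le_of_finrank_eq _ (by rw [hL.1, hW.1])
          intro x hx
          have a1 := l1 hx; have a2 := l2 hx
          simp only [LinearMap.mem_ker, LinearMap.sub_apply, LinearMap.smul_apply, smul_eq_mul] at a1 a2
          have a3 : (w - w') * b.coord 2 x = 0 := by linear_combination a2 - a1
          have a4 := (mul_eq_zero.1 a3).resolve_left (sub_ne_zero.2 hne)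
          rw [a4] at a1
          rw [← hker]
          exact ⟨a4, by simpa using a1⟩
        have ht := hAB w ((hmem w).1 hw)
        have ht' := hAB w' ((hmem w').1 hw')
        intro L h1 h2
        simp only [Finset.mem_insert, Finset.mem_singleton] at h1 h2
        have hL : IsLn T L ∧ L ≠ W ∧ L ≤ LinearMap.ker (b.coord 3 - w • b.coord 2) := by
          rcases h1 with rfl | rfl
          · exact ⟨ht.l2, ht.n12.symm, ht.le2⟩
          · exact ⟨ht.l3, ht.n13.symm, ht.le3⟩
        have hL' : L ≤ LinearMap.ker (b.coord 3 - w' • b.coord 2) := by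
          rcases h2 with rfl | rfl
          · exact ht'.le2
          · exact ht'.le3
        exact hL.2.1 (key L hL.1 hL.2.2 hL')
  · have : 0 < p.roots.toFinset.card := by omega
    obtain ⟨w, hw⟩ := Finset.card_pos.1 this
    exact ⟨_, _, _, hAB w ((hmem w).1 hw)⟩

lemma Tri.perm {P W₁ W₂ W₃ : Submodule ℂ V} (t : Tri T P W₁ W₂ W₃) : Tri T P W₂ W₃ W₁ where
  fr := t.fr
  l1 := t.l2
  l2 := t.l3
  l3 := t.l1
  le1 := t.le2
  le2 := t.le3
  le3 := t.le1
  n12 := t.n23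
  n13 := t.n12.symm
  n23 := t.n13.symm
  pt := fun x hx h => by have := t.pt x hx h; tauto
  ln := fun x hx h => by have := t.ln x hx h; tauto

/-- a line outside the tritangent plane cannot meet two of its lines -/
lemma SmCub.not_two (h : SmCub T) (hV : Module.finrank ℂ V = 4) {P W₁ W₂ W₃ : Submodule ℂ V}
    (t : Tri T P W₁ W₂ W₃) {L : Submodule ℂ V} (hL : IsLn T L) (hLP : ¬ L ≤ P)
    (m1 : L ⊓ W₁ ≠ ⊥) (m2 : L ⊓ W₂ ≠ ⊥) : False := by
  obtain ⟨q, hq, hq0⟩ := (Submodule.ne_bot_iff _).1 m1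
  obtain ⟨r, hr, hr0⟩ := (Submodule.ne_bot_iff _).1 m2
  have hlt : P < L ⊔ P := lt_of_le_of_ne le_sup_right fun he => hLP (by rw [he]; exact le_sup_left)
  have f1 := Submodule.finrank_lt_finrank_of_lt hlt
  have f2 := Submodule.finrank_le (L ⊔ P)
  have f3 := Submodule.finrank_sup_add_finrank_inf_eq L P
  have htop : L ⊔ P = ⊤ := Submodule.eq_top_of_finrank_eq (by have := t.fr; omega)
  have f4 : Module.finrank ℂ (L ⊓ P : Submodule ℂ V) = 1 := by
    have := t.fr; have := hL.1; omega
  have hrq : ∃ c : ℂ, c • q = r := by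
    have hq' : (⟨q, hq.1, t.le1 hq.2⟩ : (L ⊓ P : Submodule ℂ V)) ≠ 0 :=
      fun e => hq0 (congrArg Subtype.val e)
    obtain ⟨c, hc⟩ := (finrank_eq_one_iff_of_nonzero' _ hq').1 f4 ⟨r, hr.1, t.le2 hr.2⟩
    exact ⟨c, by simpa using congrArg Subtype.val hc⟩
  obtain ⟨c, rfl⟩ := hrq
  have hc : c ≠ 0 := by rintro rfl; simp at hr0
  have hq2 : q ∈ W₂ := (Submodule.smul_mem_iff _ hc).1 hr.2
  have hsup : W₁ ⊔ W₂ = P := by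
    apply Submodule.eq_of_le_of_finrank_le (sup_le t.le1 t.le2)
    have : W₁ < W₁ ⊔ W₂ := lt_of_le_of_ne le_sup_left fun he => t.n12
      (Submodule.eq_of_le_of_finrank_eq (by rw [he]; exact le_sup_right) (by rw [t.l1.1, t.l2.1])).symm
    have := Submodule.finrank_lt_finrank_of_lt this
    have := t.fr; have := t.l1.1; omega
  obtain ⟨y, hy⟩ := h.sm q hq0
  apply hy
  have hyt : y ∈ L ⊔ (W₁ ⊔ W₂) := by rw [hsup, htop]; trivial
  obtain ⟨y0, hy0, y', hy', rfl⟩ := Submodule.mem_sup.1 hyt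
  obtain ⟨y1, hy1, y2, hy2, rfl⟩ := Submodule.mem_sup.1 hy'
  rw [map_add, map_add, h.polar3 hL.2 hq.1 hq.1 hy0, h.polar3 t.l1.2 hq.2 hq.2 hy1,
    h.polar3 t.l2.2 hq2 hq2 hy2]
  simp

theorem SmCub.count (h : SmCub T) (hV : Module.finrank ℂ V = 4) (hex : ∃ W, IsLn T W) :
    {W : Submodule ℂ V | IsLn T W}.Finite ∧ {W : Submodule ℂ V | IsLn T W}.ncard = 27 := by
  classical
  obtain ⟨W₁, hW₁⟩ := hex
  obtain ⟨-, P, W₂, W₃, t⟩ := h.meets hV hW₁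
  obtain ⟨⟨s1, m1, c1⟩, -⟩ := h.meets hV t.l1
  obtain ⟨⟨s2, m2, c2⟩, -⟩ := h.meets hV t.l2
  obtain ⟨⟨s3, m3, c3⟩, -⟩ := h.meets hV t.l3
  have d1 : (s1 \ {W₂, W₃}).card = 8 := by
    rw [Finset.card_sdiff_of_subset, c1, Finset.card_pair t.n23]
    intro L hL
    simp only [Finset.mem_insert, Finset.mem_singleton] at hL
    rw [m1]
    rcases hL with rfl | rfl
    · exact ⟨t.l2, t.n12.symm, exists_meet t.fr t.l2.1 t.l1.1 t.le2 t.le1⟩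
    · exact ⟨t.l3, t.n13.symm, exists_meet t.fr t.l3.1 t.l1.1 t.le3 t.le1⟩
  have d2 : (s2 \ {W₁, W₃}).card = 8 := by
    rw [Finset.card_sdiff_of_subset, c2, Finset.card_pair t.n13]
    intro L hL
    simp only [Finset.mem_insert, Finset.mem_singleton] at hL
    rw [m2]
    rcases hL with rfl | rfl
    · exact ⟨t.l1, t.n12, exists_meet t.fr t.l1.1 t.l2.1 t.le1 t.le2⟩
    · exact ⟨t.l3, t.n23.symm, exists_meet t.fr t.l3.1 t.l2.1 t.le3 t.le2⟩
  have d3 : (s3 \ {W₁, W₂}).card = 8 := by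
    rw [Finset.card_sdiff_of_subset, c3, Finset.card_pair t.n12]
    intro L hL
    simp only [Finset.mem_insert, Finset.mem_singleton] at hL
    rw [m3]
    rcases hL with rfl | rfl
    · exact ⟨t.l1, t.n13, exists_meet t.fr t.l1.1 t.l3.1 t.le1 t.le3⟩
    · exact ⟨t.l2, t.n23, exists_meet t.fr t.l2.1 t.l3.1 t.le2 t.le3⟩
  have c0 : ({W₁, W₂, W₃} : Finset (Submodule ℂ V)).card = 3 :=
    Finset.card_eq_three.2 ⟨_, _, _, t.n12, t.n13, t.n23, rfl⟩
  set U : Finset (Submodule ℂ V) := (({W₁, W₂, W₃} ∪ (s1 \ {W₂, W₃})) ∪ (s2 \ {W₁, W₃})) ∪ (s3 \ {W₁, W₂}) with hU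
  have hUc : U.card = 27 := by
    rw [hU, Finset.card_union_of_disjoint, Finset.card_union_of_disjoint, Finset.card_union_of_disjoint,
      c0, d1, d2, d3]
    · rw [Finset.disjoint_left]
      intro L h1 h2
      simp only [Finset.mem_insert, Finset.mem_singleton, Finset.mem_sdiff, m1] at h1 h2
      tauto
    · rw [Finset.disjoint_left]
      intro L h1 h2
      simp only [Finset.mem_union, Finset.mem_insert, Finset.mem_singleton, Finset.mem_sdiff, m1, m2] at h1 h2
      by_cases hP : L ≤ P
      · have := t.ln L hP h2.1.1
        tauto
      · have := h.not_two hV t h2.1.1 hP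
        tauto
    · rw [Finset.disjoint_left]
      intro L h1 h2
      simp only [Finset.mem_union, Finset.mem_insert, Finset.mem_singleton, Finset.mem_sdiff, m1, m2, m3] at h1 h2
      by_cases hP : L ≤ P
      · have := t.ln L hP h2.1.1
        tauto
      · have := h.not_two hV t.perm h2.1.1 hP
        have := h.not_two hV t.perm.perm h2.1.1 hP
        tauto
  have hUe : {W : Submodule ℂ V | IsLn T W} = (U : Set (Submodule ℂ V)) := by
    ext L
    simp only [hU, Set.mem_ofPred_eq, Finset.mem_coe, Finset.mem_union, Finset.mem_insert, Finset.mem_singleton, Finset.mem_sdiff, m1, m2, m3]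
    constructor
    · intro hL
      by_cases hLP : L ≤ P
      · have := t.ln L hLP hL
        tauto
      · have hne : L ≠ W₁ ∧ L ≠ W₂ ∧ L ≠ W₃ :=
          ⟨fun e => hLP (e ▸ t.le1), fun e => hLP (e ▸ t.le2), fun e => hLP (e ▸ t.le3)⟩
        have hLPne : L ⊓ P ≠ ⊥ := by
          intro he
          have f3 := Submodule.finrank_sup_add_finrank_inf_eq L P
          rw [he, finrank_bot] at f3
          have f2 := Submodule.finrank_le (L ⊔ P)
          have := t.fr; have := hL.1; omega
        obtain ⟨q, hq, hq0⟩ := (Submodule.ne_bot_iff _).1 hLPne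
        have hm : ∀ W, q ∈ W → L ⊓ W ≠ ⊥ := fun W hqW => (Submodule.ne_bot_iff _).2 ⟨q, ⟨hq.1, hqW⟩, hq0⟩
        rcases t.pt q hq.2 (hL.2 q hq.1) with hh | hh | hh
        · have := hm _ hh; tauto
        · have := hm _ hh; tauto
        · have := hm _ hh; tauto
    · have := t.l1; have := t.l2; have := t.l3
      rintro (((( rfl | rfl | rfl) | hh) | hh) | hh) <;> tauto
  rw [hUe]
  exact ⟨U.finite_toSet, by rw [Set.ncard_coe_finset, hUc]⟩

end Count

section Dominant

lemma mvPoly_zero_of_nhds {n : ℕ} (p : MvPolynomial (Fin n) ℂ) (U : Set (Fin n → ℂ)) (z : Fin n → ℂ)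
    (hU : U ∈ nhds z) (h : ∀ x ∈ U, eval x p = 0) : p = 0 := by
  obtain ⟨O, hOU, hO, hz⟩ := mem_nhds_iff.1 hU
  obtain ⟨u, hu, huO⟩ := isOpen_pi_iff'.1 hO z hz
  apply MvPolynomial.funext_set u
  · intro i
    exact infinite_of_mem_nhds (z i) ((hu i).1.mem_nhds (hu i).2)
  · intro x hx
    rw [h x (hOU (huO hx)), map_zero]

/-- a polynomial self-map of `ℂⁿ` whose image has an interior point has dense image -/
theorem dense_of_nhds {n : ℕ} (P : Fin n → MvPolynomial (Fin n) ℂ) (z : Fin n → ℂ)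
    (hz : Set.range (fun (x : Fin n → ℂ) i => eval x (P i)) ∈ nhds z) :
    Dense (Set.range (fun (x : Fin n → ℂ) i => eval x (P i))) := by
  let φ : MvPolynomial (Fin n) ℂ →+* MvPolynomial (Fin n) ℂ := (aeval P : _ →ₐ[ℂ] _).toRingHom
  have hev : ∀ x p, eval x (φ p) = eval (fun i => eval x (P i)) p := by
    intro x p
    change eval x (aeval P p) = _
    induction p using MvPolynomial.induction_on with
    | C a => simp
    | add p q hp hq => rw [map_add, map_add, map_add, hp, hq]
    | mul_X p i hp => rw [map_mul, map_mul, map_mul, hp, aeval_X, eval_X]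
  have hinj : Function.Injective φ := by
    rw [injective_iff_map_eq_zero]
    intro p hp
    apply mvPoly_zero_of_nhds p _ z hz
    rintro _ ⟨x, rfl⟩
    rw [← hev, hp, map_zero]
  have hfp : φ.FinitePresentation := by
    apply RingHom.FinitePresentation.of_finiteType.1
    apply RingHom.FiniteType.of_comp_finiteType (f := (MvPolynomial.C : ℂ →+* _))
    have : φ.comp MvPolynomial.C = algebraMap ℂ (MvPolynomial (Fin n) ℂ) := by
      ext a
      simp [φ]
    rw [this, RingHom.finiteType_algebraMap]
    infer_instance
  obtain ⟨S, hS⟩ := PrimeSpectrum.exists_constructibleSetData_iff.2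
    (PrimeSpectrum.isConstructible_range_comap hfp)
  have hbot : (⊥ : PrimeSpectrum (MvPolynomial (Fin n) ℂ)) ∈ S.toSet := by
    rw [hS]
    refine ⟨⊥, ?_⟩
    ext p
    change φ p ∈ (⊥ : Ideal _) ↔ p ∈ (⊥ : Ideal _)
    rw [Ideal.mem_bot, Ideal.mem_bot]
    exact map_eq_zero_iff φ hinj
  rw [PrimeSpectrum.ConstructibleSetData.toSet] at hbot
  simp only [Set.mem_iUnion] at hbot
  obtain ⟨D, hDS, hD⟩ := hbot
  have hg : ∀ i, D.g i = 0 := by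
    intro i
    have := hD.1 (Set.mem_range_self i)
    exact this
  have hf : D.f ≠ 0 := by
    intro h
    apply hD.2
    rw [h]
    intro x hx
    rw [Set.mem_singleton_iff] at hx
    rw [hx]; exact Ideal.zero_mem _
  have himg : ∀ y, eval y D.f ≠ 0 → y ∈ Set.range (fun (x : Fin n → ℂ) i => eval x (P i)) := by
    intro y hy
    let my : PrimeSpectrum (MvPolynomial (Fin n) ℂ) := ⟨vanishingIdeal ℂ {y}, inferInstance⟩
    have hmy : ∀ p, p ∈ my.asIdeal ↔ eval y p = 0 := fun p => by
      rw [← MvPolynomial.coe_aeval_eq_eval]; exact mem_vanishingIdeal_singleton_iff (k := ℂ) y p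
    have : my ∈ S.toSet := by
      rw [PrimeSpectrum.ConstructibleSetData.toSet]
      simp only [Set.mem_iUnion]
      refine ⟨D, hDS, ?_, ?_⟩
      · rintro _ ⟨i, rfl⟩
        rw [hg i]; exact Ideal.zero_mem _
      · intro h
        exact hy ((hmy _).1 (h rfl))
    rw [hS] at this
    obtain ⟨q, hq⟩ := this
    obtain ⟨M, hM, hqM⟩ := Ideal.exists_le_maximal q.asIdeal q.isPrime.ne_top
    obtain ⟨x, rfl⟩ := isMaximal_iff_eq_vanishingIdeal_singleton.1 hM
    refine ⟨x, funext fun i => ?_⟩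
    have h1 : (X i - C (y i)) ∈ my.asIdeal := by rw [hmy]; simp
    rw [← hq] at h1
    have h2 : φ (X i - C (y i)) ∈ q.asIdeal := h1
    have h3 := (mem_vanishingIdeal_singleton_iff (k := ℂ) x _).1 (hqM h2)
    have h4 : eval x (φ (X i - C (y i))) = 0 := by rw [← MvPolynomial.coe_aeval_eq_eval]; exact h3
    rw [hev] at h4
    simpa [sub_eq_zero] using h4
  intro y
  rw [mem_closure_iff_nhds]
  intro U hU
  by_contra hc
  rw [Set.not_nonempty_iff_eq_empty] at hc
  apply hf
  apply mvPoly_zero_of_nhds D.f U y hU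
  intro x hx
  by_contra hx'
  have : x ∈ U ∩ Set.range (fun (x : Fin n → ℂ) i => eval x (P i)) := ⟨hx, himg x hx'⟩
  rw [hc] at this
  exact this

end Dominant
section Existence

/-- cubic form with given coefficient array -/
noncomputable def cubF (c : Fin 4 → Fin 4 → Fin 4 → ℂ) (x : Fin 4 → ℂ) : ℂ :=
  ∑ i, ∑ j, ∑ k, c i j k * x i * x j * x k

/-- coefficients of the restriction of a cubic form to a parametrized line -/
def resC {R : Type*} [CommRing R] (c : Fin 4 → Fin 4 → Fin 4 → R) (u v : Fin 4 → R) : Fin 4 → R :=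
  ![∑ i, ∑ j, ∑ k, c i j k * u i * u j * u k,
    ∑ i, ∑ j, ∑ k, c i j k * (u i * u j * v k + u i * v j * u k + v i * u j * u k),
    ∑ i, ∑ j, ∑ k, c i j k * (u i * v j * v k + v i * u j * v k + v i * v j * u k),
    ∑ i, ∑ j, ∑ k, c i j k * v i * v j * v k]

lemma cubF_line (c : Fin 4 → Fin 4 → Fin 4 → ℂ) (u v : Fin 4 → ℂ) (s t : ℂ) :
    cubF c (s • u + t • v) = s ^ 3 * resC c u v 0 + s ^ 2 * t * resC c u v 1
      + s * t ^ 2 * resC c u v 2 + t ^ 3 * resC c u v 3 := by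
  simp only [cubF, resC, Matrix.cons_val, Finset.mul_sum, ← Finset.sum_add_distrib,
    Pi.add_apply, Pi.smul_apply, smul_eq_mul]
  refine Finset.sum_congr rfl fun i _ => Finset.sum_congr rfl fun j _ =>
    Finset.sum_congr rfl fun k _ => ?_
  ring

/-- the family of cubics -/
noncomputable def famG (c : Fin 4 → Fin 4 → Fin 4 → ℂ) (θ : Fin 6 → ℂ) (x : Fin 4 → ℂ) : ℂ :=
  θ 4 * cubF c x + θ 5 * (x 0 ^ 2 * x 2 + x 1 ^ 2 * x 3)
    + (θ 0 * x 0 ^ 3 + θ 1 * (x 0 ^ 2 * x 1) + θ 2 * (x 0 * x 1 ^ 2) + θ 3 * x 1 ^ 3)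

/-- first spanning vector -/
def spU {R : Type*} [CommRing R] (x : Fin 6 → R) : Fin 4 → R := ![1, 0, x 0, x 2]
/-- second spanning vector -/
def spV {R : Type*} [CommRing R] (x : Fin 6 → R) : Fin 4 → R := ![0, 1, x 1, x 3]

/-- polynomial restriction coefficients -/
noncomputable def resP (c : Fin 4 → Fin 4 → Fin 4 → ℂ) : Fin 4 → MvPolynomial (Fin 6) ℂ :=
  resC (fun i j k => C (c i j k)) (spU X) (spV X)

/-- the polynomial map -/
noncomputable def famP (c : Fin 4 → Fin 4 → Fin 4 → ℂ) : Fin 6 → MvPolynomial (Fin 6) ℂ :=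
  ![-(X 4 * resP c 0 + X 5 * X 0), -(X 4 * resP c 1 + X 5 * X 1),
    -(X 4 * resP c 2 + X 5 * X 2), -(X 4 * resP c 3 + X 5 * X 3), X 4, X 5]

lemma eval_spU (x : Fin 6 → ℂ) (i : Fin 4) : eval x (spU X i) = spU x i := by
  fin_cases i <;> simp [spU]

lemma eval_spV (x : Fin 6 → ℂ) (i : Fin 4) : eval x (spV X i) = spV x i := by
  fin_cases i <;> simp [spV]

lemma eval_resP (c : Fin 4 → Fin 4 → Fin 4 → ℂ) (x : Fin 6 → ℂ) (i : Fin 4) :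
    eval x (resP c i) = resC c (spU x) (spV x) i := by
  fin_cases i <;>
  simp only [resP, resC, Fin.zero_eta, Fin.mk_one, Fin.reduceFinMk, Matrix.cons_val, Matrix.cons_val_zero, Matrix.cons_val_one, map_sum, map_mul, map_add, eval_C, eval_spU, eval_spV]

lemma famG_line (c : Fin 4 → Fin 4 → Fin 4 → ℂ) (x : Fin 6 → ℂ) (s t : ℂ) :
    famG c (fun i => eval x (famP c i)) (s • spU x + t • spV x) = 0 := by
  rw [famG, cubF_line]
  simp only [famP, Matrix.cons_val, Matrix.cons_val_zero, Matrix.cons_val_one, map_neg, map_add, map_mul, eval_X, eval_resP]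
  simp [spU, spV]
  ring

lemma famP_nhds (c : Fin 4 → Fin 4 → Fin 4 → ℂ) :
    ∃ z, Set.range (fun (x : Fin 6 → ℂ) i => eval x (famP c i)) ∈ nhds z := by
  have hd : ∀ (p : MvPolynomial (Fin 6) ℂ) (x : Fin 6 → ℂ),
      ∃ L : (Fin 6 → ℂ) →L[ℂ] ℂ, HasStrictFDerivAt (fun x => eval x p) L x := by
    intro p x
    induction p using MvPolynomial.induction_on with
    | C a => exact ⟨0, by simpa using hasStrictFDerivAt_const a x⟩
    | add p q hp hq =>
      obtain ⟨L, hL⟩ := hp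
      obtain ⟨M, hM⟩ := hq
      refine ⟨L + M, ?_⟩
      simp only [map_add]
      exact hL.fun_add hM
    | mul_X p i hp =>
      obtain ⟨L, hL⟩ := hp
      simp only [map_mul, eval_X]
      exact ⟨_, hL.fun_mul (hasStrictFDerivAt_apply (𝕜 := ℂ) i x)⟩
  set a : Fin 6 → ℂ := ![0, 0, 0, 0, 0, 1] with ha
  have a0 : ∀ k : Fin 4, a (Fin.castLE (by norm_num) k) = 0 := by
    intro k; fin_cases k <;> rfl
  have a4 : a 4 = 0 := rfl
  have a5 : a 5 = 1 := rfl
  choose L hL using fun k => hd (resP c k) a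
  let pr : Fin 6 → ((Fin 6 → ℂ) →L[ℂ] ℂ) := fun i => ContinuousLinearMap.proj i
  have hpr : ∀ i, HasStrictFDerivAt (fun x : Fin 6 → ℂ => x i) (pr i) a := fun i =>
    hasStrictFDerivAt_apply (𝕜 := ℂ) i a
  have hpX : ∀ i, HasStrictFDerivAt (fun x : Fin 6 → ℂ => eval x (X i)) (pr i) a := fun i => by
    simp only [eval_X]
    exact hpr i
  have hk : ∀ (k : Fin 4) (i : Fin 6), a i = 0 → HasStrictFDerivAt
      (fun x : Fin 6 → ℂ => eval x (-(X 4 * resP c k + X 5 * X i)))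
      (-(eval a (resP c k) • pr 4 + pr i)) a := by
    intro k i hi
    simp only [map_neg, map_add, map_mul, eval_X]
    have := (((hpr 4).fun_mul (hL k)).fun_add ((hpr 5).fun_mul (hpr i))).fun_neg
    refine this.congr_fderiv ?_
    ext h
    simp [a4, a5, hi]
  let D : Fin 6 → ((Fin 6 → ℂ) →L[ℂ] ℂ) :=
    ![-(eval a (resP c 0) • pr 4 + pr 0), -(eval a (resP c 1) • pr 4 + pr 1),
      -(eval a (resP c 2) • pr 4 + pr 2), -(eval a (resP c 3) • pr 4 + pr 3), pr 4, pr 5]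
  have hS : HasStrictFDerivAt (fun (x : Fin 6 → ℂ) i => eval x (famP c i))
      (ContinuousLinearMap.pi D) a := by
    rw [hasStrictFDerivAt_pi]
    intro i
    fin_cases i
    · exact hk 0 0 rfl
    · exact hk 1 1 rfl
    · exact hk 2 2 rfl
    · exact hk 3 3 rfl
    · exact hpX 4
    · exact hpX 5
  have hsurj : (ContinuousLinearMap.pi D).range = ⊤ := by
    rw [LinearMap.range_eq_top]
    intro y
    refine ⟨![-y 0 - eval a (resP c 0) * y 4, -y 1 - eval a (resP c 1) * y 4,
      -y 2 - eval a (resP c 2) * y 4, -y 3 - eval a (resP c 3) * y 4, y 4, y 5], ?_⟩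
    funext i
    fin_cases i <;> simp [D, pr]
  refine ⟨fun i => eval a (famP c i), ?_⟩
  · rw [← hS.map_nhds_eq_of_surj hsurj]
    exact Filter.range_mem_map

/-- every cubic form in four variables vanishes on a plane through the origin -/
theorem exists_line (c : Fin 4 → Fin 4 → Fin 4 → ℂ) :
    ∃ W : Submodule ℂ (Fin 4 → ℂ), Module.finrank ℂ W = 2 ∧ ∀ x ∈ W, cubF c x = 0 := by
  let K : Set (EuclideanSpace ℂ (Fin 4) × EuclideanSpace ℂ (Fin 4)) := {p | p.1 ∈ Metric.sphere 0 1 ∧ p.2 ∈ Metric.sphere 0 1 ∧ inner ℂ p.1 p.2 = 0}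
  have hK : IsCompact K := by
    have h1 : IsCompact (Metric.sphere (0 : EuclideanSpace ℂ (Fin 4)) 1 ×ˢ Metric.sphere (0 : EuclideanSpace ℂ (Fin 4)) 1) :=
      (isCompact_sphere _ _).prod (isCompact_sphere _ _)
    have h2 : IsClosed {p : EuclideanSpace ℂ (Fin 4) × EuclideanSpace ℂ (Fin 4) | inner ℂ p.1 p.2 = 0} :=
      isClosed_eq (by fun_prop) continuous_const
    have h3 : K = (Metric.sphere (0 : EuclideanSpace ℂ (Fin 4)) 1 ×ˢ Metric.sphere (0 : EuclideanSpace ℂ (Fin 4)) 1) ∩ {p : EuclideanSpace ℂ (Fin 4) × EuclideanSpace ℂ (Fin 4) | inner ℂ p.1 p.2 = 0} := by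
      ext p; simp [K, and_assoc]
    rw [h3]
    exact h1.inter_right h2
  have : CompactSpace K := isCompact_iff_compactSpace.1 hK
  let S : Set (K × (Fin 6 → ℂ)) :=
    {q | ∀ s t : ℂ, famG c q.2 (s • q.1.1.1.ofLp + t • q.1.1.2.ofLp) = 0}
  have hS : IsClosed S := by
    simp only [S, Set.ofPred_forall]
    refine isClosed_iInter fun s => isClosed_iInter fun t => isClosed_eq ?_ continuous_const
    unfold famG cubF
    simp only [Pi.add_apply, Pi.smul_apply, smul_eq_mul]
    fun_prop
  have hZ : IsClosed (Prod.snd '' S) := isClosedMap_snd_of_compactSpace _ hS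
  have hsub : Set.range (fun (x : Fin 6 → ℂ) i => eval x (famP c i)) ⊆ Prod.snd '' S := by
    rintro _ ⟨x, rfl⟩
    have hsp : ∀ w ∈ Submodule.span ℂ {spU x, spV x}, famG c (fun i => eval x (famP c i)) w = 0 := by
      intro w hw
      obtain ⟨s, t, rfl⟩ := Submodule.mem_span_pair.1 hw
      exact famG_line c x s t
    have hli : LinearIndependent ℂ ![spU x, spV x] := by
      rw [LinearIndependent.pair_iff]
      intro s t hst
      have h0 := congrFun hst 0
      have h1 := congrFun hst 1
      simp [spU, spV] at h0 h1
      exact ⟨h0, h1⟩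
    have hfr : Module.finrank ℂ (Submodule.span ℂ {spU x, spV x}) = 2 := by
      have := finrank_span_eq_card hli
      have hr : Set.range ![spU x, spV x] = {spU x, spV x} := by
        simp [Matrix.range_cons, Matrix.range_empty, Set.pair_comm]
      rw [hr] at this
      simpa using this
    let e := WithLp.linearEquiv 2 ℂ (Fin 4 → ℂ)
    let W : Submodule ℂ (EuclideanSpace ℂ (Fin 4)) :=
      (Submodule.span ℂ {spU x, spV x}).comap e.toLinearMap
    have hW : Module.finrank ℂ W = 2 := by
      rw [← hfr]
      exact (LinearEquiv.ofSubmodule' e _).finrank_eq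
    let B := (stdOrthonormalBasis ℂ W).reindex (finCongr hW)
    have hB := B.orthonormal
    refine ⟨⟨⟨((B 0 : W), (B 1 : W)), ?_, ?_, ?_⟩, _⟩, ?_, rfl⟩
    · exact mem_sphere_zero_iff_norm.2 (hB.1 0)
    · exact mem_sphere_zero_iff_norm.2 (hB.1 1)
    · exact hB.2 (show (0 : Fin 2) ≠ 1 by decide)
    · intro s t
      apply hsp
      exact Submodule.add_mem _ (Submodule.smul_mem _ _ (B 0).2) (Submodule.smul_mem _ _ (B 1).2)
  obtain ⟨z, hz⟩ := famP_nhds c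
  have huniv : Prod.snd '' S = Set.univ :=
    hZ.closure_eq ▸ ((dense_of_nhds (famP c) z hz).mono hsub).closure_eq
  have hmem : (![0, 0, 0, 0, 1, 0] : Fin 6 → ℂ) ∈ Prod.snd '' S := by rw [huniv]; trivial
  obtain ⟨⟨⟨⟨u, v⟩, hu, hv, huv⟩, θ⟩, hq, hθ⟩ := hmem
  subst hθ
  have hli : LinearIndependent ℂ ![u.ofLp, v.ofLp] := by
    have hu1 : ‖u‖ = 1 := by simpa using hu
    have hv1 : ‖v‖ = 1 := by simpa using hv
    rw [LinearIndependent.pair_iff]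
    intro s t hst
    have hst' : s • u + t • v = 0 := by
      ext i
      exact congrFun hst i
    have e1 := congrArg (inner ℂ u) hst'
    have e2 := congrArg (fun y => inner ℂ y v) hst'
    simp only [inner_add_right, inner_smul_right, inner_zero_right, inner_add_left, inner_smul_left,
      inner_zero_left, inner_self_eq_norm_sq_to_K, hu1, hv1] at e1 e2
    simp at huv
    rw [huv] at e1 e2
    constructor
    · simpa using e1
    · simpa using e2
  refine ⟨Submodule.span ℂ {u.ofLp, v.ofLp}, ?_, ?_⟩
  · have := finrank_span_eq_card hli
    have hr : Set.range ![u.ofLp, v.ofLp] = {u.ofLp, v.ofLp} := by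
      simp [Matrix.range_cons, Matrix.range_empty, Set.pair_comm]
    rw [hr] at this
    simpa using this
  · intro w hw
    obtain ⟨s, t, rfl⟩ := Submodule.mem_span_pair.1 hw
    have := hq s t
    simpa [famG] using this


end Existence
section Final

lemma pderiv_swap (i j : Fin 4) (p : MvPolynomial (Fin 4) ℂ) :
    pderiv i (pderiv j p) = pderiv j (pderiv i p) := by
  have h : ⁅(pderiv i : Derivation ℂ (MvPolynomial (Fin 4) ℂ) (MvPolynomial (Fin 4) ℂ)),
      (pderiv j : Derivation ℂ (MvPolynomial (Fin 4) ℂ) (MvPolynomial (Fin 4) ℂ))⁆ = 0 := by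
    apply MvPolynomial.derivation_ext
    intro k
    rw [Derivation.commutator_apply]
    simp only [pderiv_X, Pi.single_apply]
    split_ifs <;> simp
  have h2 := congrArg (fun D => D p) h
  simp only [Derivation.commutator_apply, Derivation.zero_apply] at h2
  exact sub_eq_zero.1 h2

lemma euler_eval {n : ℕ} {p : MvPolynomial (Fin 4) ℂ} (hp : p.IsHomogeneous n) (x : Fin 4 → ℂ) :
    ∑ i, x i * eval x (pderiv i p) = n * eval x p := by
  have := congrArg (eval x) hp.sum_X_mul_pderiv
  simpa [map_sum] using this

/-- third derivatives -/
noncomputable def d3 (f : MvPolynomial (Fin 4) ℂ) (i j k : Fin 4) : ℂ :=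
  coeff 0 (pderiv k (pderiv j (pderiv i f)))

lemma eval_pderiv_pderiv {f : MvPolynomial (Fin 4) ℂ} (hf : f.IsHomogeneous 3) (x : Fin 4 → ℂ) (i j : Fin 4) :
    eval x (pderiv j (pderiv i f)) = ∑ k, x k * d3 f i j k := by
  have h1 : (pderiv j (pderiv i f)).IsHomogeneous 1 := hf.pderiv.pderiv
  have h2 := euler_eval h1 x
  rw [Nat.cast_one, one_mul] at h2
  rw [← h2]
  refine Finset.sum_congr rfl fun k _ => ?_
  have h3 : (pderiv k (pderiv j (pderiv i f))).IsHomogeneous 0 := h1.pderiv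
  rw [← totalDegree_zero_iff_isHomogeneous, totalDegree_eq_zero_iff_eq_C] at h3
  rw [h3, eval_C]; rfl

lemma eval_pderiv {f : MvPolynomial (Fin 4) ℂ} (hf : f.IsHomogeneous 3) (x : Fin 4 → ℂ) (i : Fin 4) :
    2 * eval x (pderiv i f) = ∑ j, ∑ k, d3 f i j k * x j * x k := by
  have h1 : (pderiv i f).IsHomogeneous 2 := hf.pderiv
  have h2 := euler_eval h1 x
  rw [Nat.cast_ofNat] at h2
  rw [← h2]
  refine Finset.sum_congr rfl fun j _ => ?_
  rw [eval_pderiv_pderiv hf, Finset.mul_sum]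
  refine Finset.sum_congr rfl fun k _ => ?_
  ring

lemma eval_cubic {f : MvPolynomial (Fin 4) ℂ} (hf : f.IsHomogeneous 3) (x : Fin 4 → ℂ) :
    eval x f = cubF (fun i j k => d3 f i j k / 6) x := by
  have h2 := euler_eval hf x
  have h3 : (6 : ℂ) * eval x f = ∑ i, x i * (2 * eval x (pderiv i f)) := by
    rw [Nat.cast_ofNat] at h2
    have : ∑ i, x i * (2 * eval x (pderiv i f)) = 2 * ∑ i, x i * eval x (pderiv i f) := by
      rw [Finset.mul_sum]
      exact Finset.sum_congr rfl fun i _ => by ring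
    rw [this, h2]; ring
  have h4 : eval x f = 1 / 6 * ∑ i, x i * (2 * eval x (pderiv i f)) := by rw [← h3]; ring
  rw [h4, cubF]
  simp only [eval_pderiv hf, Finset.mul_sum]
  refine Finset.sum_congr rfl fun i _ => Finset.sum_congr rfl fun j _ =>
    Finset.sum_congr rfl fun k _ => ?_
  ring

/-- trilinear form of a coefficient array -/
noncomputable def triT (c : Fin 4 → Fin 4 → Fin 4 → ℂ) :
    (Fin 4 → ℂ) →ₗ[ℂ] (Fin 4 → ℂ) →ₗ[ℂ] (Fin 4 → ℂ) →ₗ[ℂ] ℂ :=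
  ∑ i, ∑ j, ∑ k, c i j k • (LinearMap.proj (R := ℂ) (φ := fun _ : Fin 4 => ℂ) i).smulRight
    ((LinearMap.proj (R := ℂ) (φ := fun _ : Fin 4 => ℂ) j).smulRight
      (LinearMap.proj (R := ℂ) (φ := fun _ : Fin 4 => ℂ) k))

lemma triT_apply (c : Fin 4 → Fin 4 → Fin 4 → ℂ) (x y z : Fin 4 → ℂ) :
    triT c x y z = ∑ i, ∑ j, ∑ k, c i j k * x i * y j * z k := by
  simp only [triT, LinearMap.sum_apply, LinearMap.smul_apply, LinearMap.smulRight_apply,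
    LinearMap.proj_apply, smul_eq_mul]
  refine Finset.sum_congr rfl fun i _ => Finset.sum_congr rfl fun j _ =>
    Finset.sum_congr rfl fun k _ => ?_
  ring

lemma smCub_of_smooth {f : MvPolynomial (Fin 4) ℂ} (hf : f.IsHomogeneous 3)
    (hsmooth : ∀ x : Fin 4 → ℂ, x ≠ 0 → eval x f = 0 → ∃ i : Fin 4, eval x (pderiv i f) ≠ 0) :
    SmCub (triT fun i j k => d3 f i j k / 6) := by
  have s12 : ∀ x y z, (triT fun i j k => d3 f i j k / 6) x y z = (triT fun i j k => d3 f i j k / 6) y x z := by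
    intro x y z
    rw [triT_apply, triT_apply, Finset.sum_comm]
    refine Finset.sum_congr rfl fun i _ => Finset.sum_congr rfl fun j _ =>
      Finset.sum_congr rfl fun k _ => ?_
    have : d3 f j i k = d3 f i j k := by rw [d3, d3, pderiv_swap i j]
    rw [this]; ring
  have s23 : ∀ x y z, (triT fun i j k => d3 f i j k / 6) x y z = (triT fun i j k => d3 f i j k / 6) x z y := by
    intro x y z
    rw [triT_apply, triT_apply]
    refine Finset.sum_congr rfl fun i _ => ?_
    rw [Finset.sum_comm]
    refine Finset.sum_congr rfl fun j _ => Finset.sum_congr rfl fun k _ => ?_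
    have : d3 f i k j = d3 f i j k := by rw [d3, d3, pderiv_swap j k]
    rw [this]; ring
  refine ⟨s12, s23, ?_⟩
  intro x hx
  by_cases h0 : eval x f = 0
  · obtain ⟨i, hi⟩ := hsmooth x hx h0
    refine ⟨Pi.single i 1, ?_⟩
    rw [s23, s12, triT_apply]
    have h2 := eval_pderiv hf x i
    have h3 : ∑ a, ∑ j, ∑ k, d3 f a j k / 6 * (Pi.single i (1 : ℂ) : Fin 4 → ℂ) a * x j * x k
        = eval x (pderiv i f) / 3 := by
      rw [Finset.sum_eq_single i]
      · have : eval x (pderiv i f) / 3 = 1 / 6 * (2 * eval x (pderiv i f)) := by ring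
        rw [this, h2]
        simp only [Finset.mul_sum, Pi.single_eq_same]
        refine Finset.sum_congr rfl fun j _ => Finset.sum_congr rfl fun k _ => ?_
        ring
      · intro a _ ha
        simp [Pi.single_eq_of_ne ha]
      · simp
    rw [h3]
    exact div_ne_zero hi (by norm_num)
  · refine ⟨x, ?_⟩
    rw [triT_apply]
    rw [eval_cubic hf] at h0
    exact h0

end Final

/-- **Salmon–Cayley.** A smooth cubic surface in `ℙ³_ℂ` contains exactly 27 lines.
Here the surface is the zero locus of a homogeneous degree-3 polynomial
`f ∈ ℂ[x₀,x₁,x₂,x₃]` whose gradient is nonzero at every nonzero zero of `f`, and lines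
in `ℙ³` are identified with 2-dimensional `ℂ`-linear subspaces of `ℂ⁴`. -/
theorem twentyseven_lines_on_smooth_cubic_surface
    (f : MvPolynomial (Fin 4) ℂ) (hhom : f.IsHomogeneous 3)
    (hsmooth : ∀ x : Fin 4 → ℂ, x ≠ 0 → eval x f = 0 →
      ∃ i : Fin 4, eval x (pderiv i f) ≠ 0) :
    {W : Submodule ℂ (Fin 4 → ℂ) |
        Module.finrank ℂ W = 2 ∧ ∀ x ∈ W, eval x f = 0}.Finite ∧
    {W : Submodule ℂ (Fin 4 → ℂ) |
        Module.finrank ℂ W = 2 ∧ ∀ x ∈ W, eval x f = 0}.ncard = 27 := by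
  have hT : ∀ x, eval x f = triT (fun i j k => d3 f i j k / 6) x x x := fun x => by
    rw [eval_cubic hhom, triT_apply]; rfl
  obtain ⟨W, hW, hW0⟩ := exists_line (fun i j k => d3 f i j k / 6)
  have key := (smCub_of_smooth hhom hsmooth).count (by simp)
    ⟨W, hW, fun x hx => by rw [triT_apply]; exact hW0 x hx⟩
  simp only [hT]
  exact key
end

section
/- Let k be a field of characteristic different from 2 and let K = k((t)) be the field of formal Laurent series over k. Let a₁,…,aₙ and b₁,…,bₙ be nonzero elements of k. If the diagonal symmetric bilinear forms ⟨a₁⟩ ⊥ ⋯ ⊥ ⟨aₙ⟩ and ⟨b₁⟩ ⊥ ⋯ ⊥ ⟨bₙ⟩ become isometric over K (after extending scalars along the inclusion k ⊆ k((t))), then they are already isometric over k. (A consequence of Springer's theorem computing GW(k((t))), cited in the paper's computation of Grothendieck–Witt groups of fields such as ℂ((x₁,…,xₙ)) and ℚ_p.) -/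
open Finset

/-- A Lagrangian of `V ⊥ -W` can be moved to the graph of an isometry. -/
theorem lagrangian_to_graph {k V W : Type*} [Field k] (h2 : (2 : k) ≠ 0)
    [AddCommGroup V] [Module k V] [FiniteDimensional k V]
    [AddCommGroup W] [Module k W] [FiniteDimensional k W]
    (BV : V →ₗ[k] V →ₗ[k] k) (BW : W →ₗ[k] W →ₗ[k] k)
    (sV : ∀ x y, BV x y = BV y x) (sW : ∀ x y, BW x y = BW y x)
    (nW : ∀ x, (∀ y, BW x y = 0) → x = 0) (d : ℕ) :
    ∀ L : Submodule k (V × W), (∀ p ∈ L, ∀ q ∈ L, BV p.1 q.1 = BW p.2 q.2) →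
      Module.finrank k L = Module.finrank k V →
      Module.finrank k (L ⊓ LinearMap.ker (LinearMap.fst k V W) : Submodule k (V × W)) ≤ d →
      ∃ e : V →ₗ[k] W, ∀ x y, BW (e x) (e y) = BV x y := by
  have graph : ∀ L : Submodule k (V × W), (∀ p ∈ L, ∀ q ∈ L, BV p.1 q.1 = BW p.2 q.2) →
      Module.finrank k L = Module.finrank k V →
      (L ⊓ LinearMap.ker (LinearMap.fst k V W) : Submodule k (V × W)) = ⊥ →
      ∃ e : V →ₗ[k] W, ∀ x y, BW (e x) (e y) = BV x y := by
    intro L hL hr hN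
    have inj : Function.Injective ((LinearMap.fst k V W).comp L.subtype) := by
      rw [← LinearMap.ker_eq_bot, LinearMap.ker_eq_bot']
      rintro ⟨p, hp⟩ h
      have : p ∈ (L ⊓ LinearMap.ker (LinearMap.fst k V W) : Submodule k (V × W)) := ⟨hp, by simpa using h⟩
      rw [hN] at this
      simpa using this
    let E := LinearEquiv.ofInjectiveOfFinrankEq _ inj hr
    refine ⟨((LinearMap.snd k V W).comp L.subtype).comp E.symm.toLinearMap, fun x y => ?_⟩
    have key : ∀ x, ((E.symm x : L) : V × W).1 = x := fun x => E.apply_symm_apply x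
    have := hL _ (E.symm x).2 _ (E.symm y).2
    rw [key, key] at this
    simpa using this.symm
  induction d with
  | zero =>
    intro L hL hr hN
    exact graph L hL hr (Submodule.finrank_eq_zero.mp (Nat.le_zero.mp hN))
  | succ d ih =>
    intro L hL hr hN
    by_cases hbot : (L ⊓ LinearMap.ker (LinearMap.fst k V W) : Submodule k (V × W)) = ⊥
    · exact graph L hL hr hbot
    obtain ⟨⟨b1, b⟩, ⟨hbL, hb1⟩, hb0⟩ := Submodule.exists_mem_ne_zero_of_ne_bot hbot
    obtain rfl : b1 = 0 := by simpa using hb1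
    have hb : b ≠ 0 := by rintro rfl; exact hb0 rfl
    -- v
    obtain ⟨v, hv⟩ : ∃ v : V, ∀ p ∈ L, p.1 ≠ v := by
      by_contra! hcon
      have surj : Function.Surjective ((LinearMap.fst k V W).comp L.subtype) := by
        intro v
        obtain ⟨p, hp, h⟩ := hcon v
        exact ⟨⟨p, hp⟩, h⟩
      have inj := (LinearMap.injective_iff_surjective_of_finrank_eq_finrank hr).2 surj
      have : (⟨(0, b), hbL⟩ : L) = 0 := inj (by simp)
      exact hb0 (congrArg Subtype.val this)
    obtain ⟨u, hu⟩ : ∃ u, BW b u ≠ 0 := by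
      by_contra! hcon
      exact hb (nW b hcon)
    have hbb : BW b b = 0 := by simpa using (hL _ hbL _ hbL).symm
    obtain ⟨w, hw, hbw⟩ : ∃ w, BW w w = BV v v ∧ BW w b ≠ 0 := by
      refine ⟨u + ((BV v v - BW u u) / (2 * BW b u)) • b, ?_, ?_⟩
      · simp only [map_add, map_smul, LinearMap.add_apply, LinearMap.smul_apply, smul_eq_mul, hbb,
          sW u b]
        field_simp
        ring
      · simpa [hbb, sW u b] using hu
    let φ : V × W →ₗ[k] k := (BV v).comp (LinearMap.fst k V W) - (BW w).comp (LinearMap.snd k V W)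
    have hφ : ∀ p, φ p = BV v p.1 - BW w p.2 := fun p => rfl
    let L0 : Submodule k (V × W) := L ⊓ LinearMap.ker φ
    have hL0 : Module.finrank k L0 + 1 = Module.finrank k V := by
      have hne : φ.comp L.subtype ≠ 0 := by
        intro h
        have := LinearMap.congr_fun h ⟨(0, b), hbL⟩
        simp [hφ] at this
        exact hbw this
      have h1 := Module.Dual.finrank_ker_add_one_of_ne_zero (f := φ.comp L.subtype) hne
      have h3 : L0 = (LinearMap.ker (φ.comp L.subtype)).map L.subtype := by
        rw [LinearMap.ker_comp, Submodule.map_comap_subtype]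
      have h4 := Submodule.finrank_map_subtype_eq L (LinearMap.ker (φ.comp L.subtype))
      rw [h3, h4]
      omega
    have hvw : (v, w) ∉ L := fun h => hv _ h rfl
    have mem' : ∀ p ∈ (k ∙ (v, w)) ⊔ L0, ∃ s : k, ∃ l ∈ L0, p = s • (v, w) + l := by
      intro p hp
      obtain ⟨y, hy, z, hz, rfl⟩ := Submodule.mem_sup.1 hp
      obtain ⟨s, rfl⟩ := Submodule.mem_span_singleton.1 hy
      exact ⟨s, z, hz, rfl⟩
    apply ih ((k ∙ (v, w)) ⊔ L0)
    · intro p hp q hq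
      obtain ⟨s, l, hl, rfl⟩ := mem' p hp
      obtain ⟨s', l', hl', rfl⟩ := mem' q hq
      have e1 := hL _ hl.1 _ hl'.1
      have e2 : BV v l.1 - BW w l.2 = 0 := hl.2
      have e3 : BV v l'.1 - BW w l'.2 = 0 := hl'.2
      simp only [Prod.fst_add, Prod.snd_add, Prod.smul_fst, Prod.smul_snd, map_add, map_smul,
        LinearMap.add_apply, LinearMap.smul_apply, smul_eq_mul, sV l.1 v, sW l.2 w]
      linear_combination e1 + s' * e2 + s * e3 - s * s' * hw
    · have h1 := Submodule.finrank_sup_add_finrank_inf_eq (k ∙ (v, w)) L0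
      have h0 : (v, w) ≠ 0 := fun h => hvw (h ▸ L.zero_mem)
      have h2 : (k ∙ (v, w)) ⊓ L0 = ⊥ := by
        rw [← disjoint_iff, disjoint_comm, Submodule.disjoint_span_singleton' h0]
        exact fun h => hvw h.1
      rw [h2, finrank_bot, finrank_span_singleton h0] at h1
      omega
    · have hlt : ((k ∙ (v, w)) ⊔ L0) ⊓ LinearMap.ker (LinearMap.fst k V W) <
          L ⊓ LinearMap.ker (LinearMap.fst k V W) := by
        have hle : ∀ p ∈ ((k ∙ (v, w)) ⊔ L0) ⊓ LinearMap.ker (LinearMap.fst k V W), p ∈ L0 := by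
          rintro p ⟨hp, hp1⟩
          obtain ⟨s, l, hl, rfl⟩ := mem' p hp
          by_cases hs : s = 0
          · simpa [hs] using hl
          · exfalso
            have h1 : s • v + l.1 = 0 := by simpa using hp1
            refine hv (-s⁻¹ • l) (L.smul_mem _ hl.1) ?_
            rw [Prod.smul_fst, eq_neg_of_add_eq_zero_right h1]
            simp [smul_smul, hs]
        refine lt_of_le_of_ne (fun p hp => ⟨(hle p hp).1, hp.2⟩) fun h => ?_
        have hm : ((0 : V), b) ∈ L ⊓ LinearMap.ker (LinearMap.fst k V W) := ⟨hbL, hb1⟩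
        rw [← h] at hm
        have := (hle _ hm).2
        simp [hφ] at this
        exact hbw this
      have := Submodule.finrank_lt_finrank_of_lt hlt
      omega

/-- The diagonal form. -/
noncomputable def diagB {k : Type*} [Field k] {n : ℕ} (a : Fin n → k) :
    (Fin n → k) →ₗ[k] (Fin n → k) →ₗ[k] k :=
  LinearMap.mk₂ k (fun x y => ∑ i, a i * x i * y i)
    (fun x x' y => by simp only [Pi.add_apply, ← sum_add_distrib]; congr! 1; ring)
    (fun c x y => by simp only [Pi.smul_apply, smul_eq_mul, mul_sum]; congr! 1; ring)
    (fun x x' y => by simp only [Pi.add_apply, ← sum_add_distrib]; congr! 1; ring)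
    (fun c x y => by simp only [Pi.smul_apply, smul_eq_mul, mul_sum]; congr! 1; ring)

theorem diagB_apply {k : Type*} [Field k] {n : ℕ} (a x y : Fin n → k) :
    diagB a x y = ∑ i, a i * x i * y i := rfl

theorem diagB_nondeg {k : Type*} [Field k] {n : ℕ} (a : Fin n → k) (ha : ∀ i, a i ≠ 0)
    (x : Fin n → k) (h : ∀ y, diagB a x y = 0) : x = 0 := by
  funext i
  have := h (Pi.single i 1)
  simp [diagB_apply, Pi.single_apply, ha] at this
  simpa using this

/-- The isotropic lattice in the graph of `e`. -/
def graphLattice {k : Type*} [Field k] {n : ℕ}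
    (e : (Fin n → LaurentSeries k) ≃ₗ[LaurentSeries k] (Fin n → LaurentSeries k)) :
    Submodule (PowerSeries k) ((Fin n → PowerSeries k) × (Fin n → PowerSeries k)) where
  carrier := {p | e (fun i => algebraMap (PowerSeries k) (LaurentSeries k) (p.1 i)) =
    fun i => algebraMap (PowerSeries k) (LaurentSeries k) (p.2 i)}
  zero_mem' := by
    have : (fun i : Fin n => (0 : LaurentSeries k)) = 0 := rfl
    simp [this]
  add_mem' := by
    intro p q hp hq
    simp only [Set.mem_ofPred_eq, Prod.fst_add, Prod.snd_add, Pi.add_apply, map_add] at *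
    have := congrArg₂ (· + ·) hp hq
    simp only [← map_add] at this
    exact this
  smul_mem' := by
    intro c p hp
    simp only [Set.mem_ofPred_eq, Prod.smul_fst, Prod.smul_snd, Pi.smul_apply, smul_eq_mul,
      map_mul] at *
    have := congrArg (fun z => algebraMap (PowerSeries k) (LaurentSeries k) c • z) hp
    simp only [← map_smul] at this
    exact this

theorem exists_lagrangian {k : Type*} [Field k] {n : ℕ} (a b : Fin n → k)
    (e : (Fin n → LaurentSeries k) ≃ₗ[LaurentSeries k] (Fin n → LaurentSeries k))
    (he : ∀ x y : Fin n → LaurentSeries k,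
        ∑ i, algebraMap k (LaurentSeries k) (b i) * e x i * e y i =
          ∑ i, algebraMap k (LaurentSeries k) (a i) * x i * y i) :
    ∃ L : Submodule k ((Fin n → k) × (Fin n → k)),
      (∀ p ∈ L, ∀ q ∈ L, diagB a p.1 q.1 = diagB b p.2 q.2) ∧ Module.finrank k L = n := by
  classical
  let ι := algebraMap (PowerSeries k) (LaurentSeries k)
  have ιinj : Function.Injective ι := IsFractionRing.injective _ _
  let M := graphLattice e
  have hM : ∀ p, p ∈ M ↔ e (fun i => ι (p.1 i)) = fun i => ι (p.2 i) := fun p => Iff.rfl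
  let red : (Fin n → PowerSeries k) × (Fin n → PowerSeries k) → (Fin n → k) × (Fin n → k) :=
    fun p => (fun i => PowerSeries.constantCoeff (p.1 i), fun i => PowerSeries.constantCoeff (p.2 i))
  have hC : ∀ c : k, algebraMap k (LaurentSeries k) c = ι (PowerSeries.C c) := by
    intro c
    change _ = HahnSeries.ofPowerSeries ℤ k (PowerSeries.C c)
    rw [HahnSeries.algebraMap_apply']
    rfl
  have iso : ∀ p ∈ M, ∀ q ∈ M, diagB a (red p).1 (red q).1 = diagB b (red p).2 (red q).2 := by
    intro p hp q hq
    have h := he (fun i => ι (p.1 i)) (fun i => ι (q.1 i))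
    rw [(hM p).1 hp, (hM q).1 hq] at h
    simp only [hC, ← map_mul, ← map_sum] at h
    have h' := congrArg PowerSeries.constantCoeff (ιinj h)
    simp only [map_sum, map_mul, PowerSeries.constantCoeff_C] at h'
    exact h'.symm
  have hfr : n ≤ Module.finrank (PowerSeries k) M := by
    obtain ⟨d, hd⟩ := IsLocalization.exist_integer_multiples (nonZeroDivisors (PowerSeries k))
      (Finset.univ : Finset (Fin n × Fin n)) (fun ij => e (Pi.single ij.1 1) ij.2)
    have hd0 : (d : PowerSeries k) ≠ 0 := nonZeroDivisors.ne_zero d.2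
    choose f hf using fun i j => hd (i, j) (Finset.mem_univ _)
    let g : Fin n → M := fun i => ⟨(Pi.single i (d : PowerSeries k), f i), by
      rw [hM]
      have h1 : (fun j => ι ((Pi.single i (d : PowerSeries k) : Fin n → PowerSeries k) j)) =
          ι d • (Pi.single i 1 : Fin n → LaurentSeries k) := by
        funext j
        by_cases hij : j = i
        · subst hij; simp
        · simp [hij]
      rw [h1, map_smul]
      funext j
      have := hf i j
      simp only [Algebra.smul_def] at this
      exact this.symm⟩
    have hg : LinearIndependent (PowerSeries k) g := by
      rw [Fintype.linearIndependent_iff]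
      intro c hc i
      have h1 := congrArg (fun m : M => m.1.1 i) hc
      simp [g, Prod.fst_sum, Finset.sum_apply, Pi.single_apply, hd0] at h1
      exact h1
    simpa using hg.fintype_card_le_finrank
  let B := Module.finBasis (PowerSeries k) M
  have hX : ι (PowerSeries.X) ≠ 0 := by
    rw [Ne, map_eq_zero_iff ι ιinj]; exact PowerSeries.X_ne_zero
  have li : LinearIndependent k (fun i => red (B i).1) := by
    rw [Fintype.linearIndependent_iff]
    intro c hc
    let m : M := ∑ i, PowerSeries.C (c i) • B i
    have hm : red m.1 = 0 := by
      rw [← hc]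
      ext j <;> simp [red, m, Prod.fst_sum, Prod.snd_sum, Finset.sum_apply]
    have h1 : ∀ i, PowerSeries.X ∣ m.1.1 i := fun i =>
      PowerSeries.X_dvd_iff.2 (congrFun (congrArg Prod.fst hm) i)
    have h2 : ∀ i, PowerSeries.X ∣ m.1.2 i := fun i =>
      PowerSeries.X_dvd_iff.2 (congrFun (congrArg Prod.snd hm) i)
    choose x hx using h1
    choose y hy using h2
    have hxy : (x, y) ∈ M := by
      rw [hM]
      have h := (hM _).1 m.2
      simp only [hx, hy, map_mul] at h
      have h3 : e (ι PowerSeries.X • fun i => ι (x i)) = ι PowerSeries.X • fun i => ι (y i) := h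
      rw [map_smul] at h3
      exact smul_right_injective _ hX h3
    have hmx : m = (PowerSeries.X : PowerSeries k) • (⟨(x, y), hxy⟩ : M) := by
      apply Subtype.ext
      ext1
      · funext i; exact hx i
      · funext i; exact hy i
    intro i
    have h4 := congrArg (fun z => PowerSeries.constantCoeff (B.repr z i)) hmx
    have h5 : B.repr m i = PowerSeries.C (c i) := by
      simp only [m]
      rw [B.repr_sum_self]
    simp only [h5, map_smul, Finsupp.smul_apply, smul_eq_mul, map_mul,
      PowerSeries.constantCoeff_C, PowerSeries.constantCoeff_X, zero_mul] at h4
    exact h4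
  let σ := Fin.castLE hfr
  have li' := li.comp σ (Fin.castLE_injective hfr)
  refine ⟨Submodule.span k (Set.range ((fun i => red (B i).1) ∘ σ)), ?_, ?_⟩
  · intro p hp q hq
    induction hp using Submodule.span_induction with
    | mem p hp =>
      obtain ⟨i, rfl⟩ := hp
      induction hq using Submodule.span_induction with
      | mem q hq =>
        obtain ⟨j, rfl⟩ := hq
        exact iso _ (B _).2 _ (B _).2
      | zero => simp
      | add x y _ _ hx hy => rw [Prod.fst_add, Prod.snd_add, map_add, map_add, hx, hy]
      | smul c x _ hx => rw [Prod.smul_fst, Prod.smul_snd, map_smul, map_smul, hx]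
    | zero => simp
    | add x y _ _ hx hy => simp [hx, hy]
    | smul c x _ hx => simp [hx]
  · simpa using finrank_span_eq_card li'

/-- A consequence of **Springer's theorem** for `k((t))`: if `k` has characteristic `≠ 2`
and two diagonal nondegenerate symmetric bilinear forms `⟨a₁,…,aₙ⟩` and `⟨b₁,…,bₙ⟩` with
entries in `k` become isometric over the Laurent series field `k((t))`, then they are
already isometric over `k`. -/
theorem descent_of_isometry_from_laurent_series
    (k : Type*) [Field k] (hchar : ringChar k ≠ 2) (n : ℕ)
    (a b : Fin n → k) (ha : ∀ i, a i ≠ 0) (hb : ∀ i, b i ≠ 0)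
    (H : ∃ e : (Fin n → LaurentSeries k) ≃ₗ[LaurentSeries k] (Fin n → LaurentSeries k),
      ∀ x y : Fin n → LaurentSeries k,
        ∑ i, algebraMap k (LaurentSeries k) (b i) * e x i * e y i =
          ∑ i, algebraMap k (LaurentSeries k) (a i) * x i * y i) :
    ∃ e : (Fin n → k) ≃ₗ[k] (Fin n → k),
      ∀ x y : Fin n → k,
        ∑ i, b i * e x i * e y i = ∑ i, a i * x i * y i := by

  obtain ⟨e, he⟩ := H
  obtain ⟨L, hL, hr⟩ := exists_lagrangian a b e he
  have h2 : (2 : k) ≠ 0 := Ring.two_ne_zero hchar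
  have sym : ∀ a x y : Fin n → k, diagB a x y = diagB a y x := fun a x y => by
    simp only [diagB_apply]; congr! 1; ring
  obtain ⟨f, hf⟩ := lagrangian_to_graph h2 (diagB a) (diagB b) (sym a) (sym b)
    (diagB_nondeg b hb) _ L hL (by simpa using hr) le_rfl
  have inj : Function.Injective f := by
    rw [← LinearMap.ker_eq_bot, LinearMap.ker_eq_bot']
    intro x hx
    refine diagB_nondeg a ha x fun y => ?_
    rw [← hf, hx]; simp
  exact ⟨LinearEquiv.ofInjectiveEndo f inj, fun x y => hf x y⟩
end
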